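/- arXiv:1902.08406 — 3 statements merged into one kernel-verified Lean document; each statement's English description precedes it below -/
import Mathlib

section
/- Every simply connected Poincaré DGCA of degree n of Hodge type is equivalent to a finite-dimensional nondegenerate Poincaré DGCA of degree n of Hodge type. -/
universe u v

open scoped TensorProduct

/-- A (not necessarily commutative) differential graded algebra over `F`:
a nonnegatively graded, associative, unital `F`-algebra equipped with a degree `+1`
differential `d` satisfying `d ∘ d = 0` and the graded Leibniz rule. -/
structure DGA (F : Type u) (A : Type v) [Field F] [Ring A] [Algebra F A] where
  grading : ℤ → Submodule F A
  internal : DirectSum.IsInternal grading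
  nonneg : ∀ i : ℤ, i < 0 → grading i = ⊥
  one_mem : (1 : A) ∈ grading 0
  mul_mem : ∀ {i j : ℤ} {a b : A}, a ∈ grading i → b ∈ grading j → a * b ∈ grading (i + j)
  d : A →ₗ[F] A
  d_mem : ∀ {i : ℤ} {a : A}, a ∈ grading i → d a ∈ grading (i + 1)
  d_d : ∀ a : A, d (d a) = 0
  leibniz : ∀ {i : ℤ} (a b : A), a ∈ grading i →
    d (a * b) = d a * b + ((-1 : F) ^ i) • (a * d b)

namespace DGA

variable {F : Type u} {A : Type v} [Field F] [Ring A] [Algebra F A]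

/-- The cocycles of degree `k`. -/
def Zc (D : DGA F A) (k : ℤ) : Submodule F A := D.grading k ⊓ LinearMap.ker D.d

/-- The coboundaries of degree `k`. -/
def Bc (D : DGA F A) (k : ℤ) : Submodule F A := Submodule.map D.d (D.grading (k - 1))

/-- `a` is exact, i.e. a coboundary. -/
def IsExact (D : DGA F A) (a : A) : Prop := ∃ b, a = D.d b

/-- Two elements define the same cohomology class. -/
def Cohomologous (D : DGA F A) (a b : A) : Prop := ∃ c, a - b = D.d c

/-- `H^0 = F·[1]`. -/
def Connected (D : DGA F A) : Prop :=
  ∀ a ∈ D.grading 0, D.d a = 0 → ∃ c : F, a = c • (1 : A)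

/-- Connected and `H^k = 0` for `1 ≤ k ≤ r`.  An `(r-1)`-connected DGA in the sense of
the paper is one satisfying `RConnected (r-1)`. -/
def RConnected (D : DGA F A) (r : ℤ) : Prop :=
  D.Connected ∧ ∀ k : ℤ, 1 ≤ k → k ≤ r → ∀ a ∈ D.grading k, D.d a = 0 → D.IsExact a

/-- A harmonic subspace: a graded complement of the coboundaries inside the cocycles. -/
def IsHarmonicFamily (D : DGA F A) (H : ℤ → Submodule F A) : Prop :=
  ∀ k : ℤ, H k ≤ D.Zc k ∧ Disjoint (D.Bc k) (H k) ∧ D.Zc k ≤ D.Bc k ⊔ H k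

/-- The operator `d⁻` attached to a decomposition `A = dA ⊕ H ⊕ B`: the inverse of
`d : B → dA` extended by `0` on `H ⊕ B`. -/
def IsDminus (D : DGA F A) (H B : ℤ → Submodule F A) (dm : A →ₗ[F] A) : Prop :=
  (∀ k : ℤ, ∀ b ∈ B k, dm (D.d b) = b) ∧
  (∀ k : ℤ, ∀ h ∈ H k, dm h = 0) ∧
  (∀ k : ℤ, ∀ b ∈ B k, dm b = 0) ∧
  (∀ k : ℤ, ∀ a ∈ D.grading k, dm a ∈ B (k - 1))

/-- The projection `π_H : A → H` with kernel `dA ⊕ B`. -/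
def IsHarmonicProj (D : DGA F A) (H B : ℤ → Submodule F A) (pH : A →ₗ[F] A) : Prop :=
  (∀ k : ℤ, ∀ h ∈ H k, pH h = h) ∧
  (∀ k : ℤ, ∀ b ∈ B k, pH b = 0) ∧
  (∀ a : A, pH (D.d a) = 0) ∧
  (∀ k : ℤ, ∀ a ∈ D.grading k, pH a ∈ H k)

/-- The degree of the entry `a i j` of a defining system: `|x_i| + ⋯ + |x_j| - (j - i)`. -/
def degSum (deg : ℕ → ℤ) (i j : ℕ) : ℤ :=
  (∑ t ∈ Finset.Icc i j, deg t) - ((j - i : ℕ) : ℤ)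

/-- A defining system for the `l`-th order Massey product of the classes of the
cocycles `x 1, …, x l` (of degrees `deg 1, …, deg l`). -/
def IsDefiningSystem (D : DGA F A) (l : ℕ) (deg : ℕ → ℤ) (x : ℕ → A)
    (a : ℕ → ℕ → A) : Prop :=
  (∀ i : ℕ, 1 ≤ i → i ≤ l →
      a i i ∈ D.grading (deg i) ∧ D.d (a i i) = 0 ∧ D.Cohomologous (a i i) (x i)) ∧
  (∀ i j : ℕ, 1 ≤ i → i ≤ j → j ≤ l → a i j ∈ D.grading (degSum deg i j)) ∧
  (∀ i j : ℕ, 1 ≤ i → i < j → j ≤ l → ¬(i = 1 ∧ j = l) →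
    D.d (a i j) = ∑ k ∈ Finset.Ico i j, ((-1 : F) ^ degSum deg i k) • (a i k * a (k + 1) j))

/-- The cocycle `∑ ā_{1k} a_{k+1,l}` produced by a defining system. -/
def masseyOut (D : DGA F A) (l : ℕ) (deg : ℕ → ℤ) (a : ℕ → ℕ → A) : A :=
  ∑ k ∈ Finset.Ico 1 l, ((-1 : F) ^ degSum deg 1 k) • (a 1 k * a (k + 1) l)

/-- `(x 1, …, x l)` is a Massey `l`-tuple: the Massey product is nonempty. -/
def IsMasseyTuple (D : DGA F A) (l : ℕ) (deg : ℕ → ℤ) (x : ℕ → A) : Prop :=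
  (∀ i : ℕ, 1 ≤ i → i ≤ l → x i ∈ D.Zc (deg i)) ∧ ∃ a, D.IsDefiningSystem l deg x a

/-- The `l`-th order Massey product of `(x 1, …, x l)` is trivial: it contains `0`. -/
def MasseyTrivial (D : DGA F A) (l : ℕ) (deg : ℕ → ℤ) (x : ℕ → A) : Prop :=
  ∃ a, D.IsDefiningSystem l deg x a ∧ D.IsExact (D.masseyOut l deg a)

end DGA

/-- A differential graded commutative algebra (DGCA) over `F`. -/
structure DGCA (F : Type u) (A : Type v) [Field F] [Ring A] [Algebra F A]
    extends DGA F A where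
  gcomm : ∀ {i j : ℤ} (a b : A), a ∈ grading i → b ∈ grading j →
    a * b = ((-1 : F) ^ (i * j)) • (b * a)

/-- A Poincaré DGCA of degree `n`: a DGCA concentrated in degrees `0, …, n`, with finite
dimensional cohomology, equipped with a linear functional `∫` (given here as `intg`, a
functional on `A` vanishing in degrees `≠ n` and on coboundaries) such that the induced
pairing `⟨a, b⟩ = ∫ [a * b]` is nondegenerate on cohomology. -/
structure PoincareDGCA (F : Type u) (A : Type v) [Field F] [Ring A] [Algebra F A]
    (n : ℤ) extends DGCA F A where
  top : ∀ i : ℤ, n < i → grading i = ⊥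
  fin_cohomology : ∀ k : ℤ, ∃ W : Submodule F A, FiniteDimensional F W ∧
    ∀ a ∈ grading k, d a = 0 → ∃ w ∈ W, ∃ c, a - w = d c
  intg : A →ₗ[F] F
  intg_deg : ∀ i : ℤ, i ≠ n → ∀ a ∈ grading i, intg a = 0
  intg_d : ∀ a : A, intg (d a) = 0
  nondeg : ∀ i : ℤ, ∀ a ∈ grading i, d a = 0 →
    (∀ b ∈ grading (n - i), d b = 0 → intg (a * b) = 0) → ∃ c, a = d c

namespace PoincareDGCA

variable {F : Type u} {A : Type v} [Field F] [Ring A] [Algebra F A] {n : ℤ}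

/-- The null space `A⊥` of the induced pairing `⟨a, b⟩ = ∫ (a * b)` on `A`. -/
def perp (P : PoincareDGCA F A n) : Submodule F A :=
  ⨅ b : A, LinearMap.ker (P.intg ∘ₗ LinearMap.mulRight F b)

/-- `A = dA ⊕ H ⊕ B` is a Hodge type decomposition: `H` is a harmonic subspace,
`B` is a graded complement, and `⟨H ⊕ B, B⟩ = 0`. -/
def IsHodge (P : PoincareDGCA F A n) (H B : ℤ → Submodule F A) : Prop :=
  P.toDGA.IsHarmonicFamily H ∧
  (∀ k : ℤ, B k ≤ P.grading k) ∧
  (∀ k : ℤ, Disjoint (P.toDGA.Bc k ⊔ H k) (B k)) ∧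
  (∀ k : ℤ, P.grading k ≤ P.toDGA.Bc k ⊔ H k ⊔ B k) ∧
  (∀ j k : ℤ, ∀ a ∈ H j ⊔ B j, ∀ b ∈ B k, P.intg (a * b) = 0)

/-- A Poincaré DGCA of Hodge type: one admitting a Hodge type decomposition. -/
def HodgeType (P : PoincareDGCA F A n) : Prop := ∃ H B, P.IsHodge H B

end PoincareDGCA

/-- A bundled DGCA over `F`. -/
structure BDGCA (F : Type u) [Field F] : Type (max (u + 1) (v + 1)) where
  carrier : Type v
  [ringInst : Ring carrier]
  [algInst : Algebra F carrier]
  str : DGCA F carrier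

attribute [instance] BDGCA.ringInst BDGCA.algInst

/-- A morphism of DGCAs: an algebra homomorphism preserving the grading and
commuting with the differentials. -/
structure DGCAHom {F : Type u} [Field F] (X Y : BDGCA.{u, v} F) where
  f : X.carrier →ₐ[F] Y.carrier
  map_grading : ∀ i : ℤ, ∀ a ∈ X.str.grading i, f a ∈ Y.str.grading i
  map_d : ∀ a, f (X.str.d a) = Y.str.d (f a)

/-- A quasi-isomorphism: a DGCA morphism inducing an isomorphism on cohomology. -/
def DGCAHom.QuasiIso {F : Type u} [Field F] {X Y : BDGCA.{u, v} F}
    (φ : DGCAHom X Y) : Prop :=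
  (∀ i : ℤ, ∀ a ∈ X.str.grading i, X.str.d a = 0 →
    (∃ b, φ.f a = Y.str.d b) → ∃ c, a = X.str.d c) ∧
  (∀ i : ℤ, ∀ a' ∈ Y.str.grading i, Y.str.d a' = 0 →
    ∃ a ∈ X.str.grading i, X.str.d a = 0 ∧ ∃ b, φ.f a - a' = Y.str.d b)

/-- Two DGCAs are equivalent if they are joined by a finite zig-zag of
quasi-isomorphisms. -/
def DGCAEquivalent {F : Type u} [Field F] : BDGCA.{u, v} F → BDGCA.{u, v} F → Prop :=
  Relation.EqvGen fun X Y => ∃ φ : DGCAHom X Y, φ.QuasiIso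

/-- A DGCA is formal if it is equivalent to a DGCA with zero differential
(equivalently, to its cohomology with the zero differential). -/
def DGCAFormal {F : Type u} [Field F] (X : BDGCA.{u, v} F) : Prop :=
  ∃ Y : BDGCA.{u, v} F, Y.str.d = 0 ∧ DGCAEquivalent X Y

/-- A family of submodules that is separated by linear maps `p i` (each fixing the `i`-th member
and killing the others) and that spans the module is an internal direct sum decomposition. -/
theorem isInternal_of_projections {F M : Type*} [Field F] [AddCommGroup M] [Module F M]
    (G : ℤ → Submodule F M) (p : ℤ → M →ₗ[F] M)
    (hsame : ∀ i, ∀ m ∈ G i, p i m = m) (hne : ∀ i j, i ≠ j → ∀ m ∈ G i, p j m = 0)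
    (htop : ∀ m, m ∈ ⨆ i, G i) : DirectSum.IsInternal G := by
  rw [DirectSum.isInternal_submodule_iff_iSupIndep_and_iSup_eq_top]
  refine ⟨fun i => Submodule.disjoint_def.2 fun x hx hx' => ?_,
    eq_top_iff.2 fun m _ => htop m⟩
  have hker : (⨆ (j : ℤ) (_ : j ≠ i), G j) ≤ LinearMap.ker (p i) :=
    iSup₂_le fun j hj m hm => hne j i hj m hm
  rw [← hsame i x hx]
  exact hker hx'

namespace DGA

variable {F : Type*} {A : Type*} [Field F] [Ring A] [Algebra F A]

/-- The projection onto the degree `i` component. -/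
noncomputable def proj (D : DGA F A) (i : ℤ) : A →ₗ[F] A :=
  letI := D.internal.chooseDecomposition
  (D.grading i).subtype ∘ₗ DirectSum.component F ℤ (fun i => D.grading i) i ∘ₗ
    (DirectSum.decomposeLinearEquiv D.grading).toLinearMap

theorem proj_mem (D : DGA F A) (i : ℤ) (x : A) : D.proj i x ∈ D.grading i :=
  Submodule.coe_mem _

theorem proj_of_mem (D : DGA F A) {i : ℤ} {x : A} (hx : x ∈ D.grading i) : D.proj i x = x := by
  let := D.internal.chooseDecomposition
  exact DirectSum.decompose_of_mem_same D.grading hx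

theorem proj_of_mem_ne (D : DGA F A) {i j : ℤ} {x : A} (hx : x ∈ D.grading i) (hij : i ≠ j) :
    D.proj j x = 0 := by
  let := D.internal.chooseDecomposition
  exact DirectSum.decompose_of_mem_ne D.grading hx hij

theorem exists_sum_proj (D : DGA F A) (x : A) : ∃ s : Finset ℤ, ∑ i ∈ s, D.proj i x = x := by
  classical
  let := D.internal.chooseDecomposition
  exact ⟨_, DirectSum.sum_support_decompose D.grading x⟩

theorem mem_of_proj_mem (D : DGA F A) (U : Submodule F A) {x : A} (h : ∀ i, D.proj i x ∈ U) :
    x ∈ U := by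
  obtain ⟨s, hs⟩ := D.exists_sum_proj x
  rw [← hs]
  exact Submodule.sum_mem _ fun i _ => h i

theorem eq_zero_of_proj (D : DGA F A) {x : A} (h : ∀ i, D.proj i x = 0) : x = 0 := by
  have := D.mem_of_proj_mem ⊥ (x := x) fun i => by simp [h i]
  simpa using this

theorem mem_of_homogeneous (D : DGA F A) (U : Submodule F A)
    (h : ∀ i, ∀ x ∈ D.grading i, x ∈ U) (x : A) : x ∈ U :=
  D.mem_of_proj_mem U fun i => h i _ (D.proj_mem i x)

theorem proj_d (D : DGA F A) (i : ℤ) (x : A) : D.proj (i + 1) (D.d x) = D.d (D.proj i x) := by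
  have := D.mem_of_homogeneous
    (LinearMap.eqLocus (D.proj (i + 1) ∘ₗ D.d) (D.d ∘ₗ D.proj i)) (fun j a ha => ?_) x
  · exact this
  · simp only [LinearMap.mem_eqLocus, LinearMap.comp_apply]
    by_cases hj : j = i
    · subst hj
      rw [D.proj_of_mem ha, D.proj_of_mem (D.d_mem ha)]
    · rw [D.proj_of_mem_ne ha hj, D.proj_of_mem_ne (D.d_mem ha) (by omega), map_zero]

theorem proj_d' (D : DGA F A) (i : ℤ) (x : A) : D.proj i (D.d x) = D.d (D.proj (i - 1) x) := by
  rw [← D.proj_d, sub_add_cancel]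

theorem d_one (D : DGA F A) : D.d 1 = 0 := by
  have := D.leibniz 1 1 D.one_mem
  simpa using this

theorem mem_Bc (D : DGA F A) {k : ℤ} {x : A} : x ∈ D.Bc k ↔ x ∈ D.grading k ∧ ∃ c, x = D.d c := by
  constructor
  · rintro ⟨c, hc, rfl⟩
    exact ⟨by simpa using D.d_mem hc, c, rfl⟩
  · rintro ⟨hx, c, rfl⟩
    refine ⟨D.proj (k - 1) c, D.proj_mem _ _, ?_⟩
    rw [← D.proj_d', D.proj_of_mem hx]

/-- Elements of a supremum of graded pieces of a graded family have components in the family. -/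
theorem proj_mem_of_mem_iSup (D : DGA F A) (B : ℤ → Submodule F A) (hB : ∀ k, B k ≤ D.grading k)
    {x : A} (hx : x ∈ ⨆ k, B k) (i : ℤ) : D.proj i x ∈ B i := by
  have : (⨆ k, B k) ≤ (B i).comap (D.proj i) := iSup_le fun k b hb => by
    rw [Submodule.mem_comap]
    by_cases hk : k = i
    · subst hk
      rwa [D.proj_of_mem (hB k hb)]
    · rw [D.proj_of_mem_ne (hB k hb) hk]
      exact zero_mem _
  exact this hx

/-- The quotient of a DGA by a differential homogeneous ideal, presented as a surjective
algebra homomorphism with section `s`. -/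
noncomputable def mapSurj (D : DGA F A) {Q : Type*} [Ring Q] [Algebra F Q] (f : A →ₐ[F] Q)
    (s : Q →ₗ[F] A) (hs : ∀ y, f (s y) = y)
    (hproj : ∀ x, f x = 0 → ∀ i, f (D.proj i x) = 0) (hd : ∀ x, f x = 0 → f (D.d x) = 0) :
    DGA F Q :=
  have hdf : ∀ x, f (D.d (s (f x))) = f (D.d x) := fun x => by
    rw [← sub_eq_zero, ← map_sub, ← map_sub]
    exact hd _ (by simp [hs])
  have hpf : ∀ i x, f (D.proj i (s (f x))) = f (D.proj i x) := fun i x => by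
    rw [← sub_eq_zero, ← map_sub, ← map_sub]
    exact hproj _ (by simp [hs]) i
  { grading := fun i => (D.grading i).map f.toLinearMap
    internal := by
      refine isInternal_of_projections _
        (fun i => f.toLinearMap ∘ₗ D.proj i ∘ₗ s) ?_ ?_ ?_
      · rintro i _ ⟨x, hx, rfl⟩
        simpa [D.proj_of_mem hx] using hpf i x
      · rintro i j hij _ ⟨x, hx, rfl⟩
        simpa [D.proj_of_mem_ne hx hij] using hpf j x
      · intro y
        have := D.mem_of_homogeneous
          ((⨆ i, (D.grading i).map f.toLinearMap).comap f.toLinearMap)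
          (fun i x hx => Submodule.mem_iSup_of_mem i ⟨x, hx, rfl⟩) (s y)
        simpa [hs] using this
    nonneg := fun i hi => by rw [D.nonneg i hi, Submodule.map_bot]
    one_mem := ⟨1, D.one_mem, map_one f⟩
    mul_mem := by
      rintro i j _ _ ⟨x, hx, rfl⟩ ⟨y, hy, rfl⟩
      exact ⟨x * y, D.mul_mem hx hy, map_mul f x y⟩
    d := f.toLinearMap ∘ₗ D.d ∘ₗ s
    d_mem := by
      rintro i _ ⟨x, hx, rfl⟩
      exact ⟨D.d x, D.d_mem hx, (hdf x).symm⟩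
    d_d := fun a => by
      have := hdf (D.d (s a))
      simpa [D.d_d] using this
    leibniz := by
      rintro i _ b ⟨x, hx, rfl⟩
      obtain ⟨y, rfl⟩ : ∃ y, f y = b := ⟨s b, hs b⟩
      have h := hdf (x * y)
      rw [D.leibniz x y hx] at h
      have hx' := hdf x
      have hy' := hdf y
      simp only [map_mul, map_add, map_smul] at h
      simpa [hx', hy'] using h }

theorem mapSurj_d (D : DGA F A) {Q : Type*} [Ring Q] [Algebra F Q] (f : A →ₐ[F] Q)
    (s : Q →ₗ[F] A) (hs : ∀ y, f (s y) = y)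
    (hproj : ∀ x, f x = 0 → ∀ i, f (D.proj i x) = 0) (hd : ∀ x, f x = 0 → f (D.d x) = 0) (x : A) :
    (D.mapSurj f s hs hproj hd).d (f x) = f (D.d x) := by
  change f (D.d (s (f x))) = f (D.d x)
  rw [← sub_eq_zero, ← map_sub, ← map_sub]
  exact hd _ (by simp [hs])

/-- A graded subalgebra closed under the differential is a DGA. -/
noncomputable def restrict (D : DGA F A) (S : Subalgebra F A)
    (hproj : ∀ x ∈ S, ∀ i, D.proj i x ∈ S) (hd : ∀ x ∈ S, D.d x ∈ S) : DGA F S where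
  grading := fun i => (D.grading i).comap S.val.toLinearMap
  internal := by
    refine isInternal_of_projections _
      (fun i => (D.proj i).restrict (p := S.toSubmodule) (q := S.toSubmodule)
        fun x hx => hproj x hx i) ?_ ?_ ?_
    · exact fun i m hm => Subtype.ext (D.proj_of_mem hm)
    · exact fun i j hij m hm => Subtype.ext (D.proj_of_mem_ne hm hij)
    · intro m
      obtain ⟨t, ht⟩ := D.exists_sum_proj (m : A)
      have : m = ∑ i ∈ t, (⟨D.proj i m, hproj m m.2 i⟩ : S) := Subtype.ext (by simp [ht])
      rw [this]
      exact Submodule.sum_mem _ fun i _ => Submodule.mem_iSup_of_mem i (D.proj_mem i m)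
  nonneg := fun i hi => by
    rw [D.nonneg i hi, eq_bot_iff]
    intro x hx
    simpa using hx
  one_mem := D.one_mem
  mul_mem := fun ha hb => D.mul_mem ha hb
  d := D.d.restrict (p := S.toSubmodule) (q := S.toSubmodule) hd
  d_mem := fun ha => D.d_mem ha
  d_d := fun a => Subtype.ext (D.d_d a)
  leibniz := fun a b ha => Subtype.ext (D.leibniz (a : A) b ha)

/-- `d⁻` exists for every graded decomposition `A = dA ⊕ H ⊕ B` with `H` harmonic. -/
theorem exists_isDminus (D : DGA F A) {H B : ℤ → Submodule F A} (hH : D.IsHarmonicFamily H)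
    (hB : ∀ k, B k ≤ D.grading k) (hdisj : ∀ k, Disjoint (D.Bc k ⊔ H k) (B k))
    (hcov : ∀ k, D.grading k ≤ D.Bc k ⊔ H k ⊔ B k) : ∃ dm, D.IsDminus H B dm := by
  have hHg : ∀ k, H k ≤ D.grading k := fun k x hx => ((hH k).1 hx).1
  have hHd : ∀ k, ∀ x ∈ H k, D.d x = 0 := fun k x hx => ((hH k).1 hx).2
  have hBker : IsCompl (⨆ k, B k) (LinearMap.ker D.d) := by
    refine ⟨Submodule.disjoint_def.2 fun x hx hx' => D.eq_zero_of_proj fun i => ?_,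
      codisjoint_iff.2 (eq_top_iff.2 fun x _ => D.mem_of_homogeneous _ (fun i a ha => ?_) x)⟩
    · have hxB := D.proj_mem_of_mem_iSup B hB hx i
      refine Submodule.disjoint_def.1 (hdisj i) _ ((hH i).2.2 ⟨D.proj_mem i x, ?_⟩) hxB
      rw [SetLike.mem_coe, LinearMap.mem_ker, ← D.proj_d, LinearMap.mem_ker.1 hx', map_zero]
    · obtain ⟨y, hy, b, hb, rfl⟩ := Submodule.mem_sup.1 (hcov i ha)
      obtain ⟨z, hz, h, hh, rfl⟩ := Submodule.mem_sup.1 hy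
      obtain ⟨-, c, rfl⟩ := D.mem_Bc.1 hz
      refine add_mem (Submodule.mem_sup_right ?_)
        (Submodule.mem_sup_left (Submodule.mem_iSup_of_mem i hb))
      simp [D.d_d, hHd i h hh]
  have hrange : IsCompl (LinearMap.range D.d) ((⨆ k, H k) ⊔ ⨆ k, B k) := by
    refine ⟨Submodule.disjoint_def.2 ?_,
      codisjoint_iff.2 (eq_top_iff.2 fun x _ => D.mem_of_homogeneous _ (fun i a ha => ?_) x)⟩
    · rintro _ ⟨c, rfl⟩ hx
      obtain ⟨h, hh, b, hb, hc⟩ := Submodule.mem_sup.1 hx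
      refine D.eq_zero_of_proj fun i => ?_
      have hh' := D.proj_mem_of_mem_iSup H hHg hh i
      have hb' := D.proj_mem_of_mem_iSup B hB hb i
      have hci : D.proj i (D.d c) ∈ D.Bc i := D.mem_Bc.2 ⟨D.proj_mem _ _, _, D.proj_d' i c⟩
      have hsum : D.proj i h + D.proj i b = D.proj i (D.d c) := by rw [← map_add, hc]
      have hb0 : D.proj i b = 0 := by
        refine Submodule.disjoint_def.1 (hdisj i) _ ?_ hb'
        rw [← add_sub_cancel_left (D.proj i h) (D.proj i b), hsum]
        exact sub_mem (Submodule.mem_sup_left hci) (Submodule.mem_sup_right hh')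
      rw [hb0, add_zero] at hsum
      exact Submodule.disjoint_def.1 (hH i).2.1 _ hci (hsum ▸ hh')
    · obtain ⟨y, hy, b, hb, rfl⟩ := Submodule.mem_sup.1 (hcov i ha)
      obtain ⟨z, hz, h, hh, rfl⟩ := Submodule.mem_sup.1 hy
      obtain ⟨-, c, rfl⟩ := D.mem_Bc.1 hz
      rw [add_assoc]
      exact add_mem (Submodule.mem_sup_left ⟨c, rfl⟩) (Submodule.mem_sup_right
        (add_mem (Submodule.mem_sup_left (Submodule.mem_iSup_of_mem i hh))
          (Submodule.mem_sup_right (Submodule.mem_iSup_of_mem i hb))))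
  let e := LinearMap.kerComplementEquivRange D.d hBker
  let dm : A →ₗ[F] A := (⨆ k, B k).subtype ∘ₗ e.symm.toLinearMap ∘ₗ
    Submodule.projectionOnto _ _ hrange
  have hdB : ∀ k, ∀ b ∈ B k, dm (D.d b) = b := fun k b hb => by
    have hb' : b ∈ ⨆ k, B k := Submodule.mem_iSup_of_mem k hb
    have he : e ⟨b, hb'⟩ = ⟨D.d b, b, rfl⟩ := Subtype.ext rfl
    have hp : Submodule.projectionOnto _ _ hrange (D.d b) = ⟨D.d b, b, rfl⟩ :=
      Submodule.projectionOnto_apply_left hrange ⟨D.d b, b, rfl⟩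
    simp only [dm, LinearMap.comp_apply, hp, ← he]
    simp
  have hzero : ∀ x ∈ (⨆ k, H k) ⊔ ⨆ k, B k, dm x = 0 := fun x hx => by
    simp only [dm, LinearMap.comp_apply]
    rw [(Submodule.projectionOnto_apply_eq_zero_iff hrange).2 hx]
    simp
  have hdH : ∀ k, ∀ h ∈ H k, dm h = 0 := fun k h hh =>
    hzero h (Submodule.mem_sup_left (Submodule.mem_iSup_of_mem k hh))
  have hdB0 : ∀ k, ∀ b ∈ B k, dm b = 0 := fun k b hb =>
    hzero b (Submodule.mem_sup_right (Submodule.mem_iSup_of_mem k hb))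
  refine ⟨dm, hdB, hdH, hdB0, fun k a ha => ?_⟩
  obtain ⟨y, hy, b, hb, rfl⟩ := Submodule.mem_sup.1 (hcov k ha)
  obtain ⟨z, ⟨c, hc, rfl⟩, h, hh, rfl⟩ := Submodule.mem_sup.1 hy
  obtain ⟨y', hy', b', hb', rfl⟩ := Submodule.mem_sup.1 (hcov _ hc)
  obtain ⟨z', hz', h', hh', rfl⟩ := Submodule.mem_sup.1 hy'
  obtain ⟨-, c', rfl⟩ := D.mem_Bc.1 hz'
  simpa [D.d_d, hHd _ h' hh', hdB _ b' hb', hdH _ h hh, hdB0 _ b hb] using hb'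

end DGA

namespace PoincareDGCA

section Hodge

variable {F : Type*} {A : Type*} [Field F] [Ring A] [Algebra F A] {n : ℤ}
  {P : PoincareDGCA F A n} {H B : ℤ → Submodule F A} {dm : A →ₗ[F] A}

theorem IsHodge.exists_decomp (hP : P.IsHodge H B) {k : ℤ} {a : A} (ha : a ∈ P.grading k) :
    ∃ b ∈ B (k - 1), ∃ h ∈ H k, ∃ b' ∈ B k, a = P.d b + h + b' := by
  obtain ⟨hH, hB, -, hcov, -⟩ := hP
  obtain ⟨y, hy, b', hb', rfl⟩ := Submodule.mem_sup.1 (hcov k ha)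
  obtain ⟨z, ⟨c, hc, rfl⟩, h, hh, rfl⟩ := Submodule.mem_sup.1 hy
  obtain ⟨y₁, hy₁, b, hb, rfl⟩ := Submodule.mem_sup.1 (hcov _ hc)
  obtain ⟨z₁, hz₁, h₁, hh₁, rfl⟩ := Submodule.mem_sup.1 hy₁
  obtain ⟨-, c₁, rfl⟩ := P.mem_Bc.1 hz₁
  have hd : P.d h₁ = 0 := ((hH _).1 hh₁).2
  exact ⟨b, hb, h, hh, b', hb', by simp [P.d_d, hd]⟩

theorem IsHodge.exists_isDminus (hP : P.IsHodge H B) : ∃ dm, P.toDGA.IsDminus H B dm :=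
  P.toDGA.exists_isDminus hP.1 hP.2.1 hP.2.2.1 hP.2.2.2.1

theorem IsHodge.H_le (hP : P.IsHodge H B) (k : ℤ) : H k ≤ P.grading k := fun _ hx =>
  ((hP.1 k).1 hx).1

theorem IsHodge.B_le (hP : P.IsHodge H B) (k : ℤ) : B k ≤ P.grading k := hP.2.1 k

theorem IsHodge.d_H (hP : P.IsHodge H B) {k : ℤ} {h : A} (hh : h ∈ H k) : P.d h = 0 :=
  ((hP.1 k).1 hh).2

/-- The harmonic projection `1 - d d⁻ - d⁻ d`. -/
def harm (P : PoincareDGCA F A n) (dm : A →ₗ[F] A) : A →ₗ[F] A :=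
  LinearMap.id - P.d ∘ₗ dm - dm ∘ₗ P.d

theorem decomp (P : PoincareDGCA F A n) (dm : A →ₗ[F] A) (x : A) :
    x = P.d (dm x) + dm (P.d x) + P.harm dm x := by
  simp only [harm, LinearMap.sub_apply, LinearMap.id_apply, LinearMap.comp_apply]
  abel

theorem IsHodge.isHarmonicProj (hP : P.IsHodge H B) (hdm : P.toDGA.IsDminus H B dm) :
    P.toDGA.IsHarmonicProj H B (P.harm dm) := by
  obtain ⟨h1, h2, h3, h4⟩ := hdm
  have hdd : ∀ c, P.d (dm (P.d c)) = P.d c := fun c => by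
    refine P.mem_of_homogeneous (LinearMap.eqLocus (P.d ∘ₗ dm ∘ₗ P.d) P.d) (fun k a ha => ?_) c
    obtain ⟨b, hb, h, hh, b', hb', rfl⟩ := hP.exists_decomp ha
    simp [P.d_d, hP.d_H hh, h1 _ b' hb']
  refine ⟨fun k h hh => ?_, fun k b hb => ?_, fun a => ?_, fun k a ha => ?_⟩
  · simp [harm, h2 k h hh, hP.d_H hh]
  · simp [harm, h3 k b hb, h1 k b hb]
  · simp [harm, hdd, P.d_d]
  · obtain ⟨b, hb, h, hh, b', hb', rfl⟩ := hP.exists_decomp ha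
    have : P.harm dm (P.d b + h + b') = h := by
      simp [harm, P.d_d, hP.d_H hh, h1 _ b hb, h1 _ b' hb', h2 _ h hh, h3 _ b' hb']
      abel
    rwa [this]

theorem intg_d_mul (P : PoincareDGCA F A n) {i : ℤ} {a : A} (ha : a ∈ P.grading i) (b : A) :
    P.intg (P.d a * b) = -((-1 : F) ^ i * P.intg (a * P.d b)) := by
  have := P.intg_d (a * b)
  rw [P.leibniz a b ha, map_add, map_smul, smul_eq_mul] at this
  exact eq_neg_of_add_eq_zero_left this

theorem intg_d_mul_eq_zero (P : PoincareDGCA F A n) (a : A) {b : A} (hb : P.d b = 0) :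
    P.intg (P.d a * b) = 0 := by
  refine P.mem_of_homogeneous
    (LinearMap.ker (P.intg ∘ₗ LinearMap.mulRight F b ∘ₗ P.d)) (fun k a ha => ?_) a
  simp [P.intg_d_mul ha, hb]

theorem intg_mul_d_eq_zero (P : PoincareDGCA F A n) {i : ℤ} {a : A} (ha : a ∈ P.grading i)
    (hda : P.d a = 0) (b : A) : P.intg (a * P.d b) = 0 := by
  have h := P.intg_d_mul ha b
  rw [hda, zero_mul, map_zero, eq_comm, neg_eq_zero] at h
  exact (mul_eq_zero.1 h).resolve_left (zpow_ne_zero _ (by simp))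

theorem intg_mul_comm (P : PoincareDGCA F A n) {i j : ℤ} {a b : A} (ha : a ∈ P.grading i)
    (hb : b ∈ P.grading j) : P.intg (a * b) = (-1 : F) ^ (i * j) * P.intg (b * a) := by
  rw [P.gcomm a b ha hb, map_smul, smul_eq_mul]

theorem mem_perp (P : PoincareDGCA F A n) {a : A} :
    a ∈ P.perp ↔ ∀ b, P.intg (a * b) = 0 := by
  simp [perp]

theorem mem_perp_of_homogeneous (P : PoincareDGCA F A n) {a : A}
    (h : ∀ j, ∀ b ∈ P.grading j, P.intg (a * b) = 0) : a ∈ P.perp :=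
  P.mem_perp.2 fun b => P.mem_of_homogeneous
    (LinearMap.ker (P.intg ∘ₗ LinearMap.mulLeft F a)) (fun j b hb => by simpa using h j b hb) b

theorem intg_mul_eq_zero_of_ne (P : PoincareDGCA F A n) {i j : ℤ} (hij : i + j ≠ n) {a b : A}
    (ha : a ∈ P.grading i) (hb : b ∈ P.grading j) : P.intg (a * b) = 0 :=
  P.intg_deg _ hij _ (P.mul_mem ha hb)

theorem intg_proj_mul (P : PoincareDGCA F A n) {j : ℤ} (a : A) {b : A} (hb : b ∈ P.grading j) :
    P.intg (P.toDGA.proj (n - j) a * b) = P.intg (a * b) := by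
  refine P.mem_of_homogeneous (LinearMap.eqLocus
    (P.intg ∘ₗ LinearMap.mulRight F b ∘ₗ P.toDGA.proj (n - j))
    (P.intg ∘ₗ LinearMap.mulRight F b)) (fun i a ha => ?_) a
  simp only [LinearMap.mem_eqLocus, LinearMap.comp_apply, LinearMap.mulRight_apply]
  by_cases hij : i = n - j
  · rw [← hij, P.proj_of_mem ha]
  · rw [P.proj_of_mem_ne ha hij, zero_mul, map_zero,
      P.intg_mul_eq_zero_of_ne (by omega) ha hb]

theorem proj_mem_perp (P : PoincareDGCA F A n) {a : A} (ha : a ∈ P.perp) (i : ℤ) :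
    P.toDGA.proj i a ∈ P.perp := by
  refine P.mem_perp_of_homogeneous fun j b hb => ?_
  by_cases hij : i = n - j
  · rw [hij, P.intg_proj_mul a hb, P.mem_perp.1 ha]
  · exact P.intg_mul_eq_zero_of_ne (by omega) (P.proj_mem _ _) hb

/-- To check that a linear map sends the null space into a submodule, homogeneous elements
suffice. -/
theorem map_perp_mem (P : PoincareDGCA F A n) {M : Type*} [AddCommGroup M] [Module F M]
    (g : A →ₗ[F] M) (V : Submodule F M)
    (h : ∀ i, ∀ a ∈ P.grading i, a ∈ P.perp → g a ∈ V) {a : A} (ha : a ∈ P.perp) : g a ∈ V :=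
  P.mem_of_proj_mem (V.comap g) fun i => h i _ (P.proj_mem i a) (P.proj_mem_perp ha i)

theorem mul_mem_perp_right (P : PoincareDGCA F A n) {a : A} (ha : a ∈ P.perp) (c : A) :
    a * c ∈ P.perp :=
  P.mem_perp.2 fun b => by rw [mul_assoc, P.mem_perp.1 ha]

theorem mul_mem_perp_left (P : PoincareDGCA F A n) {a : A} (ha : a ∈ P.perp) (c : A) :
    c * a ∈ P.perp := by
  refine P.map_perp_mem (LinearMap.mulLeft F c) P.perp (fun i a hai ha => ?_) ha
  refine P.mem_of_homogeneous (P.perp.comap (LinearMap.mulRight F a)) (fun j c hc => ?_) c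
  simp only [Submodule.mem_comap, LinearMap.mulRight_apply]
  rw [P.gcomm c a hc hai]
  exact Submodule.smul_mem _ _ (P.mul_mem_perp_right ha c)

theorem d_mem_perp (P : PoincareDGCA F A n) {a : A} (ha : a ∈ P.perp) : P.d a ∈ P.perp := by
  refine P.map_perp_mem P.d P.perp (fun i a hai ha => P.mem_perp.2 fun b => ?_) ha
  rw [P.intg_d_mul hai, P.mem_perp.1 ha, mul_zero, neg_zero]

theorem IsHodge.intg_mul_eq_zero_left (hP : P.IsHodge H B) {i j : ℤ} {a b : A}
    (ha : a ∈ B i) (hb : b ∈ H j ⊔ B j) : P.intg (a * b) = 0 := by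
  rw [P.intg_mul_comm (hP.B_le i ha) (sup_le (hP.H_le j) (hP.B_le j) hb),
    hP.2.2.2.2 j i b hb a ha, mul_zero]

theorem IsHodge.harm_perp (hP : P.IsHodge H B) (hdm : P.toDGA.IsDminus H B dm) {a : A}
    (ha : a ∈ P.perp) : P.harm dm a = 0 := by
  obtain ⟨p1, p2, p3, p4⟩ := hP.isHarmonicProj hdm
  refine (Submodule.mem_bot F).1 (P.map_perp_mem (P.harm dm) ⊥ (fun i a hai ha => ?_) ha)
  have hHa := p4 i a hai
  rw [Submodule.mem_bot]
  suffices h : ∀ b ∈ P.grading (n - i), P.d b = 0 → P.intg (P.harm dm a * b) = 0 by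
    obtain ⟨c, hc⟩ := P.nondeg i _ (hP.H_le i hHa) (hP.d_H hHa) h
    rw [← p1 i _ hHa, hc, p3]
  · intro b hb hdb
    have hb' := P.decomp dm b
    rw [hdb, map_zero, add_zero] at hb'
    have hHb := p4 _ b hb
    rw [hb', mul_add, map_add, P.intg_mul_d_eq_zero (hP.H_le i hHa) (hP.d_H hHa), zero_add]
    have hx := P.decomp dm a
    have hBa : dm (P.d a) ∈ B i := by
      have := hdm.2.2.2 _ _ (P.d_mem hai)
      rwa [add_sub_cancel_right] at this
    have := P.mem_perp.1 ha (P.harm dm b)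
    rwa [hx, add_mul, add_mul, map_add, map_add, P.intg_d_mul_eq_zero _ (hP.d_H hHb),
      hP.intg_mul_eq_zero_left hBa (Submodule.mem_sup_left hHb), zero_add, zero_add] at this

theorem IsHodge.dm_mem_perp (hP : P.IsHodge H B) (hdm : P.toDGA.IsDminus H B dm) {a : A}
    (ha : a ∈ P.perp) : dm a ∈ P.perp := by
  obtain ⟨p1, p2, p3, p4⟩ := hP.isHarmonicProj hdm
  refine P.map_perp_mem dm P.perp (fun i a hai ha => P.mem_perp_of_homogeneous fun j b hb => ?_) ha
  have hda := hdm.2.2.2 i a hai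
  obtain ⟨b₁, hb₁, h, hh, b₂, hb₂, rfl⟩ := hP.exists_decomp hb
  rw [add_assoc, mul_add, map_add, hP.intg_mul_eq_zero_left hda
    (add_mem (Submodule.mem_sup_left hh) (Submodule.mem_sup_right hb₂)), add_zero]
  have h1 := P.intg_d_mul (hP.B_le _ hda) b₁
  have hx := P.decomp dm a
  have hBa : dm (P.d a) ∈ B i := by
    have := hdm.2.2.2 _ _ (P.d_mem hai)
    rwa [add_sub_cancel_right] at this
  have h2 := P.mem_perp.1 ha b₁
  rw [hx, hP.harm_perp hdm ha, add_zero, add_mul, map_add,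
    hP.intg_mul_eq_zero_left hBa (Submodule.mem_sup_right hb₁), add_zero] at h2
  rw [h2, eq_comm, neg_eq_zero] at h1
  exact (mul_eq_zero.1 h1).resolve_left (zpow_ne_zero _ (by simp))

/-- The null space as a two-sided ideal. -/
def perpIdeal (P : PoincareDGCA F A n) : Ideal A :=
  { P.perp with smul_mem' := fun c _ hx => P.mul_mem_perp_left hx c }

instance (P : PoincareDGCA F A n) : P.perpIdeal.IsTwoSided :=
  ⟨fun b ha => P.mul_mem_perp_right ha b⟩

end Hodge

end PoincareDGCA

namespace PoincareDGCA

section Quotient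

variable {F : Type u} {A Q : Type v} [Field F] [Ring A] [Algebra F A] [Ring Q] [Algebra F Q]
  {n : ℤ} {P : PoincareDGCA F A n} {H B : ℤ → Submodule F A}

/-- The quotient of a finite dimensional Poincaré DGCA of Hodge type by its null space is a
nondegenerate Poincaré DGCA of Hodge type, and the quotient map is a quasi-isomorphism. -/
theorem IsHodge.exists_quotient (hP : P.IsHodge H B) [FiniteDimensional F Q] (f : A →ₐ[F] Q)
    (hf : Function.Surjective f) (hker : ∀ x, f x = 0 ↔ x ∈ P.perp) :
    ∃ PQ : PoincareDGCA F Q n, PQ.perp = ⊥ ∧ PQ.HodgeType ∧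
      ∃ φ : DGCAHom (BDGCA.mk A P.toDGCA) (BDGCA.mk Q PQ.toDGCA), φ.QuasiIso := by
  obtain ⟨dm, hdm⟩ := hP.exists_isDminus
  obtain ⟨p1, p2, p3, p4⟩ := hP.isHarmonicProj hdm
  obtain ⟨s, hs'⟩ := LinearMap.exists_rightInverse_of_surjective f.toLinearMap
    (LinearMap.range_eq_top.2 hf)
  have hs : ∀ y, f (s y) = y := fun y => LinearMap.congr_fun hs' y
  have hproj : ∀ x, f x = 0 → ∀ i, f (P.toDGA.proj i x) = 0 := fun x hx i =>
    (hker _).2 (P.proj_mem_perp ((hker _).1 hx) i)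
  have hd : ∀ x, f x = 0 → f (P.d x) = 0 := fun x hx =>
    (hker _).2 (P.d_mem_perp ((hker _).1 hx))
  have hdm0 : ∀ x, f x = 0 → f (dm x) = 0 := fun x hx =>
    (hker _).2 (hP.dm_mem_perp hdm ((hker _).1 hx))
  let D := P.toDGA.mapSurj f s hs hproj hd
  have hDd : ∀ x, D.d (f x) = f (P.d x) := P.toDGA.mapSurj_d f s hs hproj hd
  let I : Q →ₗ[F] F := P.intg ∘ₗ s
  have hI : ∀ x, I (f x) = P.intg x := fun x => by
    have h := P.mem_perp.1 ((hker _).1 (show f (s (f x) - x) = 0 by simp [hs])) 1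
    rw [mul_one, map_sub, sub_eq_zero] at h
    exact h
  have hg : ∀ {i x}, x ∈ P.grading i → f x ∈ D.grading i := fun hx => ⟨_, hx, rfl⟩
  have hdec : ∀ x, f (P.d x) = 0 → f x = D.d (f (dm x)) + f (P.harm dm x) := fun x hx => by
    conv_lhs => rw [P.decomp dm x]
    rw [map_add, map_add, hdm0 _ hx, add_zero, hDd]
  have hclosed : ∀ x, f (P.d x) = 0 → ∀ i, x ∈ P.grading i →
      ∃ x' ∈ P.grading i, P.d x' = 0 ∧ f x' = f x := fun x hx i hxi => by
    refine ⟨P.d (dm x) + P.harm dm x, add_mem ?_ (hP.H_le i (p4 i x hxi)), ?_, ?_⟩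
    · have := P.d_mem (hP.B_le _ (hdm.2.2.2 i x hxi))
      rwa [sub_add_cancel] at this
    · rw [map_add, P.d_d, hP.d_H (p4 i x hxi), add_zero]
    · rw [hdec x hx, map_add, hDd]
  let PQ : PoincareDGCA F Q n :=
    { D with
      gcomm := by
        rintro i j _ _ ⟨x, hx, rfl⟩ ⟨y, hy, rfl⟩
        have := congrArg f (P.gcomm x y hx hy)
        simpa using this
      top := fun i hi => by
        change (P.grading i).map f.toLinearMap = ⊥
        rw [P.top i hi, Submodule.map_bot]
      fin_cohomology := fun k => ⟨⊤, inferInstance, fun a _ _ => ⟨a, trivial, 0, by simp⟩⟩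
      intg := I
      intg_deg := by
        rintro i hi _ ⟨x, hx, rfl⟩
        exact (hI x).trans (P.intg_deg i hi x hx)
      intg_d := fun a => by
        obtain ⟨x, rfl⟩ := hf a
        rw [hDd, hI, P.intg_d]
      nondeg := by
        rintro i _ ⟨x, hx, rfl⟩ hdx hb
        obtain ⟨x', hx', hdx', hfx⟩ := hclosed x (by rw [← hDd]; exact hdx) i hx
        obtain ⟨c, hc⟩ := P.nondeg i x' hx' hdx' fun b hbg hdb => by
          have := hb (f b) (hg hbg) (by rw [hDd, hdb, map_zero])
          rw [← hI, map_mul, hfx]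
          exact this
        refine ⟨f c, ?_⟩
        rw [hDd, ← hc, hfx]
        rfl }
  refine ⟨PQ, ?_, ⟨fun k => (H k).map f.toLinearMap, fun k => (B k).map f.toLinearMap,
    ?_, ?_, ?_, ?_, ?_⟩, ⟨f, fun i a ha => hg ha, fun a => (hDd a).symm⟩, ?_, ?_⟩
  · rw [eq_bot_iff]
    intro y hy
    obtain ⟨x, rfl⟩ := hf y
    refine (Submodule.mem_bot F).2 ((hker x).2 (P.mem_perp.2 fun b => ?_))
    have := PQ.mem_perp.1 hy (f b)
    rwa [← map_mul, hI] at this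
  · refine fun k => ⟨?_, Submodule.disjoint_def.2 ?_, ?_⟩
    · rintro _ ⟨h, hh, rfl⟩
      refine ⟨hg (hP.H_le k hh), ?_⟩
      exact (hDd h).trans (by rw [hP.d_H hh, map_zero])
    · rintro _ ⟨_, ⟨c, -, rfl⟩, rfl⟩ ⟨h, hh, hhc⟩
      have h0 : f (h - P.d c) = 0 := by
        rw [map_sub, sub_eq_zero, ← hDd]
        exact hhc
      have h1 := hP.harm_perp hdm ((hker _).1 h0)
      rw [map_sub, p1 k h hh, p3, sub_zero] at h1
      rw [← hhc, h1, map_zero]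
    · rintro _ ⟨⟨x, hx, rfl⟩, hdx⟩
      have h0 : f (P.d x) = 0 := by
        rw [← hDd]
        exact hdx
      refine Submodule.mem_sup.2 ⟨_, ⟨f (dm x), hg (hP.B_le _ (hdm.2.2.2 k x hx)), rfl⟩,
        f (P.harm dm x), ⟨_, p4 k x hx, rfl⟩, (hdec x h0).symm⟩
  · exact fun k => Submodule.map_mono (hP.B_le k)
  · refine fun k => Submodule.disjoint_def.2 ?_
    rintro _ hy ⟨b, hb, rfl⟩
    obtain ⟨_, ⟨_, ⟨c, -, rfl⟩, rfl⟩, _, ⟨h, hh, rfl⟩, hsum⟩ := Submodule.mem_sup.1 hy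
    have h0 : f (P.d c + h - b) = 0 := by
      rw [map_sub, map_add, sub_eq_zero, ← hDd]
      exact hsum
    have h1 := hdm0 _ (hd _ h0)
    rw [map_sub, map_add, P.d_d, hP.d_H hh, zero_add, zero_sub, map_neg, hdm.1 k b hb, map_neg,
      neg_eq_zero] at h1
    exact h1
  · rintro k _ ⟨x, hx, rfl⟩
    obtain ⟨b, hb, h, hh, b', hb', rfl⟩ := hP.exists_decomp hx
    change f (P.d b + h + b') ∈ _
    rw [map_add, map_add, ← hDd]
    exact add_mem (Submodule.mem_sup_left (add_mem
      (Submodule.mem_sup_left ⟨f b, hg (hP.B_le _ hb), rfl⟩)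
      (Submodule.mem_sup_right ⟨h, hh, rfl⟩))) (Submodule.mem_sup_right ⟨b', hb', rfl⟩)
  · rintro j k a ha _ ⟨b, hb, rfl⟩
    rw [← Submodule.map_sup] at ha
    obtain ⟨a, ha, rfl⟩ := ha
    change I (f a * f b) = 0
    rw [← map_mul, hI, hP.2.2.2.2 j k a ha b hb]
  · rintro i a - hda ⟨b, hb⟩
    obtain ⟨c, rfl⟩ := hf b
    have hb' : f a = f (P.d c) := hb.trans (hDd c)
    have h0 : f (a - P.d c) = 0 := by rw [map_sub, hb', sub_self]
    have h1 := P.decomp dm (a - P.d c)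
    have hda' : P.d a = 0 := hda
    rw [hP.harm_perp hdm ((hker _).1 h0), map_sub P.d, hda', P.d_d, sub_zero, map_zero, add_zero,
      add_zero, sub_eq_iff_eq_add, ← map_add] at h1
    exact ⟨_, h1⟩
  · rintro i _ ⟨x, hx, rfl⟩ hdx
    obtain ⟨x', hx', hdx', hfx⟩ := hclosed x (by rw [← hDd]; exact hdx) i hx
    refine ⟨x', hx', hdx', 0, ?_⟩
    rw [map_zero, sub_eq_zero]
    exact hfx

end Quotient

section Restrict

variable {F : Type u} {A : Type v} [Field F] [Ring A] [Algebra F A]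
  {n : ℤ} {P : PoincareDGCA F A n} {H B : ℤ → Submodule F A} {dm : A →ₗ[F] A}

/-- A finite dimensional graded subalgebra containing the harmonic subspace and closed under `d`
and `d⁻` is a Poincaré DGCA of Hodge type, and its inclusion is a quasi-isomorphism. -/
theorem IsHodge.exists_restrict (hP : P.IsHodge H B) (hdm : P.toDGA.IsDminus H B dm)
    (S : Subalgebra F A) [FiniteDimensional F S]
    (hproj : ∀ x ∈ S, ∀ i, P.toDGA.proj i x ∈ S) (hd : ∀ x ∈ S, P.d x ∈ S)
    (hdmS : ∀ x ∈ S, dm x ∈ S) (hHS : ∀ k, ∀ h ∈ H k, h ∈ S) :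
    ∃ PS : PoincareDGCA F S n, PS.HodgeType ∧
      ∃ φ : DGCAHom (BDGCA.mk S PS.toDGCA) (BDGCA.mk A P.toDGCA), φ.QuasiIso := by
  obtain ⟨p1, p2, p3, p4⟩ := hP.isHarmonicProj hdm
  let D := P.toDGA.restrict S hproj hd
  have hexact : ∀ x : S, (∃ c, (x : A) = P.d c) → ∃ c, x = D.d c := by
    rintro x ⟨c, hc⟩
    have h1 := P.decomp dm x
    rw [hc, p3, P.d_d, map_zero, add_zero, add_zero, ← hc] at h1
    exact ⟨⟨dm x, hdmS x x.2⟩, Subtype.ext h1⟩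
  let PS : PoincareDGCA F S n :=
    { D with
      gcomm := fun a b ha hb => Subtype.ext (P.gcomm (a : A) b ha hb)
      top := fun i hi => by
        change (P.grading i).comap S.val.toLinearMap = ⊥
        rw [P.top i hi, eq_bot_iff]
        intro x hx
        simpa using hx
      fin_cohomology := fun k => ⟨⊤, inferInstance, fun a _ _ => ⟨a, trivial, 0, by simp⟩⟩
      intg := P.intg ∘ₗ S.val.toLinearMap
      intg_deg := fun i hi a ha => P.intg_deg i hi a ha
      intg_d := fun a => P.intg_d a
      nondeg := fun i a ha hda hb => by
        have hda' : P.d a = 0 := congrArg Subtype.val hda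
        refine hexact a (P.nondeg i a ha hda' fun b hbg hdb => ?_)
        have h1 := P.decomp dm b
        have hHb := p4 _ b hbg
        rw [hdb, map_zero, add_zero] at h1
        rw [h1, mul_add, map_add, P.intg_mul_d_eq_zero (i := i) (a := (a : A)) ha hda', zero_add]
        exact hb ⟨P.harm dm b, hHS _ _ hHb⟩ (hP.H_le _ hHb) (Subtype.ext (hP.d_H hHb)) }
  have hBc : ∀ k, ∀ x ∈ D.Bc k, (x : A) ∈ P.toDGA.Bc k := by
    rintro k _ ⟨c, hc, rfl⟩
    exact ⟨c, hc, rfl⟩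
  have hharm : ∀ x ∈ S, P.harm dm x ∈ S := fun x hx =>
    sub_mem (sub_mem hx (hd _ (hdmS x hx))) (hdmS _ (hd x hx))
  have hcov : ∀ k, ∀ x : S, (x : A) ∈ P.grading k → ∃ y ∈ D.Bc k,
      ∃ z : S, (z : A) ∈ H k ∧ x = y + z + ⟨dm (P.d x), hdmS _ (hd _ x.2)⟩ := fun k x hx =>
    ⟨_, ⟨⟨dm x, hdmS x x.2⟩, hP.B_le _ (hdm.2.2.2 k x hx), rfl⟩, ⟨P.harm dm x, hharm x x.2⟩,
      p4 k x hx, Subtype.ext ((P.decomp dm x).trans (add_right_comm _ _ _))⟩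
  refine ⟨PS, ⟨fun k => (H k).comap S.val.toLinearMap, fun k => (B k).comap S.val.toLinearMap,
    ?_, ?_, ?_, ?_, ?_⟩, ⟨S.val, fun i a ha => ha, fun a => rfl⟩, ?_, ?_⟩
  · refine fun k => ⟨fun x hx => ⟨hP.H_le k hx, Subtype.ext (hP.d_H hx)⟩,
      Submodule.disjoint_def.2 fun x hx hxH => Subtype.ext ?_, fun x hx => ?_⟩
    · exact Submodule.disjoint_def.1 (hP.1 k).2.1 _ (hBc k x hx) hxH
    · obtain ⟨y, hy, z, hz, hxyz⟩ := hcov k x hx.1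
      have hdx : P.d x = 0 := congrArg Subtype.val hx.2
      refine Submodule.mem_sup.2 ⟨y, hy, z, hz, ?_⟩
      rw [hxyz]
      refine (add_eq_left.2 (Subtype.ext ?_)).symm
      simp [hdx]
  · exact fun k x hx => hP.B_le k hx
  · refine fun k => Submodule.disjoint_def.2 fun x hx hxB => Subtype.ext ?_
    obtain ⟨y, hy, z, hz, rfl⟩ := Submodule.mem_sup.1 hx
    exact Submodule.disjoint_def.1 (hP.2.2.1 k) _
      (add_mem (Submodule.mem_sup_left (hBc k y hy)) (Submodule.mem_sup_right hz)) hxB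
  · intro k x hx
    obtain ⟨y, hy, z, hz, hxyz⟩ := hcov k x hx
    rw [hxyz]
    refine add_mem (Submodule.mem_sup_left (add_mem (Submodule.mem_sup_left hy)
      (Submodule.mem_sup_right hz))) (Submodule.mem_sup_right ?_)
    have := hdm.2.2.2 _ _ (P.d_mem hx)
    rwa [add_sub_cancel_right] at this
  · intro j k a ha b hb
    refine hP.2.2.2.2 j k a ?_ b hb
    obtain ⟨y, hy, z, hz, rfl⟩ := Submodule.mem_sup.1 ha
    exact add_mem (Submodule.mem_sup_left hy) (Submodule.mem_sup_right hz)
  · exact fun i a _ _ hb => hexact a hb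
  · intro i a ha hda
    have hda' : P.d a = 0 := hda
    have hHa := p4 i a ha
    have h1 := P.decomp dm a
    rw [hda', map_zero, add_zero] at h1
    refine ⟨⟨P.harm dm a, hHS i _ hHa⟩, hP.H_le i hHa, Subtype.ext (hP.d_H hHa), -dm a, ?_⟩
    change P.harm dm a - a = P.d (-dm a)
    rw [map_neg, sub_eq_iff_eq_add, eq_neg_add_iff_add_eq]
    exact h1.symm

end Restrict

end PoincareDGCA

namespace DGA

section GradedGE

variable {F : Type*} {A : Type*} [Field F] [Ring A] [Algebra F A]

/-- `U` is spanned by homogeneous elements of degree at least `r`. -/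
def GradedGE (D : DGA F A) (r : ℤ) (U : Submodule F A) : Prop :=
  U ≤ Submodule.span F {x | x ∈ U ∧ ∃ k, r ≤ k ∧ x ∈ D.grading k}

/-- The part of `A` of degree at least `r`. -/
def filt (D : DGA F A) (r : ℤ) : Submodule F A :=
  Submodule.span F {x | ∃ k, r ≤ k ∧ x ∈ D.grading k}

variable {D : DGA F A} {r s : ℤ} {U V : Submodule F A}

theorem GradedGE.le_filt (h : D.GradedGE r U) : U ≤ D.filt r :=
  h.trans (Submodule.span_mono fun _ hx => hx.2)

theorem GradedGE.mono (hrs : s ≤ r) (h : D.GradedGE r U) : D.GradedGE s U :=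
  h.trans (Submodule.span_mono fun _ ⟨hx, k, hk, hxk⟩ => ⟨hx, k, hrs.trans hk, hxk⟩)

theorem GradedGE.iSup {ι : Sort*} {U : ι → Submodule F A} (h : ∀ i, D.GradedGE r (U i)) :
    D.GradedGE r (⨆ i, U i) :=
  iSup_le fun i => (h i).trans (Submodule.span_mono fun _ ⟨hx, hk⟩ =>
    ⟨Submodule.mem_iSup_of_mem i hx, hk⟩)

theorem GradedGE.sup (hU : D.GradedGE r U) (hV : D.GradedGE r V) : D.GradedGE r (U ⊔ V) := by
  rw [sup_eq_iSup]
  exact GradedGE.iSup fun b => by cases b <;> assumption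

theorem GradedGE.mul (hU : D.GradedGE r U) (hV : D.GradedGE s V) :
    D.GradedGE (r + s) (U * V) := by
  refine (mul_le_mul' hU hV).trans ?_
  rw [Submodule.span_mul_span]
  refine Submodule.span_mono ?_
  rintro _ ⟨x, ⟨hx, k, hk, hxk⟩, y, ⟨hy, l, hl, hyl⟩, rfl⟩
  exact ⟨Submodule.mul_mem_mul hx hy, k + l, add_le_add hk hl, D.mul_mem hxk hyl⟩

theorem GradedGE.map {g : A →ₗ[F] A} {t : ℤ}
    (hg : ∀ k, ∀ x ∈ D.grading k, g x ∈ D.grading (k + t)) (hU : D.GradedGE r U) :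
    D.GradedGE (r + t) (U.map g) := by
  refine (Submodule.map_mono hU).trans ?_
  rw [Submodule.map_span]
  refine Submodule.span_mono ?_
  rintro _ ⟨x, ⟨hx, k, hk, hxk⟩, rfl⟩
  exact ⟨⟨x, hx, rfl⟩, k + t, by omega, hg k x hxk⟩

theorem GradedGE.of_le (hr : r ≤ s) (hU : U ≤ D.grading s) : D.GradedGE r U := fun _ hx =>
  Submodule.subset_span ⟨hx, s, hr, hU hx⟩

theorem gradedGE_filt (D : DGA F A) (r : ℤ) : D.GradedGE r (D.filt r) :=
  Submodule.span_mono fun _ hx => ⟨Submodule.subset_span hx, hx⟩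

theorem filt_anti (D : DGA F A) (h : s ≤ r) : D.filt r ≤ D.filt s :=
  ((D.gradedGE_filt r).mono h).le_filt

theorem GradedGE.proj_mem (hU : D.GradedGE r U) {x : A} (hx : x ∈ U) (i : ℤ) :
    D.proj i x ∈ U := by
  have : U ≤ U.comap (D.proj i) := hU.trans <| Submodule.span_le.2 fun y ⟨hy, k, _, hyk⟩ => by
    rw [SetLike.mem_coe, Submodule.mem_comap]
    by_cases hki : k = i
    · subst hki
      rwa [D.proj_of_mem hyk]
    · rw [D.proj_of_mem_ne hyk hki]
      exact zero_mem _
  exact this hx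

theorem d_mul_mem (hU : D.GradedGE r U) (hd : ∀ x ∈ U, D.d x ∈ U) :
    ∀ x ∈ U * U, D.d x ∈ U * U := by
  have : U * U ≤ (U * U).comap D.d := by
    refine Submodule.mul_le.2 fun x hx y hy => ?_
    have : U ≤ (U * U).comap (D.d ∘ₗ LinearMap.mulRight F y) :=
      hU.trans <| Submodule.span_le.2 fun z ⟨hz, k, _, hzk⟩ => by
        rw [SetLike.mem_coe, Submodule.mem_comap, LinearMap.comp_apply, LinearMap.mulRight_apply,
          D.leibniz z y hzk]
        exact add_mem (Submodule.mul_mem_mul (hd z hz) hy)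
          (Submodule.smul_mem _ _ (Submodule.mul_mem_mul hz (hd y hy)))
    exact this hx
  exact this

end GradedGE

end DGA

namespace PoincareDGCA

section Small

variable {F : Type*} {A : Type*} [Field F] [Ring A] [Algebra F A]
  {n : ℤ} {P : PoincareDGCA F A n} {H B : ℤ → Submodule F A} {dm : A →ₗ[F] A}

theorem filt_eq_bot (P : PoincareDGCA F A n) {r : ℤ} (hr : n < r) : P.toDGA.filt r = ⊥ := by
  rw [DGA.filt, Submodule.span_eq_bot]
  rintro x ⟨k, hk, hx⟩
  rwa [P.top k (by omega), Submodule.mem_bot] at hx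

theorem IsHodge.fg_H (hP : P.IsHodge H B) (k : ℤ) : (H k).FG := by
  obtain ⟨dm, hdm⟩ := hP.exists_isDminus
  obtain ⟨p1, p2, p3, p4⟩ := hP.isHarmonicProj hdm
  obtain ⟨W, hW, h⟩ := P.fin_cohomology k
  have hle : H k ≤ W.map (P.harm dm) := fun x hx => by
    obtain ⟨w, hw, c, hc⟩ := h x (hP.H_le k hx) (hP.d_H hx)
    refine ⟨w, hw, ?_⟩
    rw [← p1 k x hx, eq_comm, ← sub_eq_zero, p1 k x hx]
    have := congrArg (P.harm dm) hc
    rwa [map_sub, p1 k x hx, p3] at this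
  have := Submodule.finiteDimensional_of_le hle
  exact (Submodule.fg_iff_finiteDimensional _).2 this

/-- The harmonic elements of degree at least `2`. -/
def harmGE (H : ℤ → Submodule F A) (n : ℤ) : Submodule F A := ⨆ k ∈ Finset.Icc 2 n, H k

theorem IsHodge.le_harmGE (hP : P.IsHodge H B) {k : ℤ} (hk : 2 ≤ k) : H k ≤ harmGE H n := by
  by_cases hn : k ≤ n
  · exact le_iSup₂_of_le k (Finset.mem_Icc.2 ⟨hk, hn⟩) le_rfl
  · refine (hP.H_le k).trans ?_
    rw [P.top k (by omega)]
    exact bot_le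

/-- One step of the construction of the small algebra. -/
def smallStep (H : ℤ → Submodule F A) (n : ℤ) (dm : A →ₗ[F] A) (U : Submodule F A) :
    Submodule F A :=
  harmGE H n ⊔ (U * U ⊔ (U * U).map dm)

/-- The iterates of `smallStep` starting at `⊥`. -/
def smallSeq (H : ℤ → Submodule F A) (n : ℤ) (dm : A →ₗ[F] A) : ℕ → Submodule F A
  | 0 => ⊥
  | m + 1 => smallStep H n dm (smallSeq H n dm m)

theorem smallStep_mono {U V : Submodule F A} (h : U ≤ V) :
    smallStep H n dm U ≤ smallStep H n dm V :=
  have hm : U * U ≤ V * V := mul_le_mul' h h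
  sup_le_sup_left (sup_le_sup hm (Submodule.map_mono hm)) _

theorem smallSeq_le_succ (m : ℕ) : smallSeq H n dm m ≤ smallSeq H n dm (m + 1) := by
  induction m with
  | zero => exact bot_le
  | succ m ih => exact smallStep_mono ih

theorem fg_smallSeq (hP : P.IsHodge H B) (m : ℕ) : (smallSeq H n dm m).FG := by
  induction m with
  | zero => exact Submodule.fg_bot
  | succ m ih =>
    exact (Submodule.fg_biSup _ _ fun k _ => hP.fg_H k).sup
      ((ih.mul ih).sup ((ih.mul ih).map dm))

theorem IsHodge.dm_mem (hP : P.IsHodge H B) (hdm : P.toDGA.IsDminus H B dm) :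
    ∀ k, ∀ x ∈ P.grading k, dm x ∈ P.grading (k + -1) := fun k x hx =>
  hP.B_le _ (hdm.2.2.2 k x hx)

theorem gradedGE_smallSeq (hP : P.IsHodge H B) (hdm : P.toDGA.IsDminus H B dm) (m : ℕ) :
    P.toDGA.GradedGE 2 (smallSeq H n dm m) := by
  induction m with
  | zero => exact bot_le
  | succ m ih =>
    refine DGA.GradedGE.sup (DGA.GradedGE.iSup fun k => DGA.GradedGE.iSup fun hk =>
      DGA.GradedGE.of_le (Finset.mem_Icc.1 hk).1 (hP.H_le k)) (DGA.GradedGE.sup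
      ((ih.mul ih).mono (by norm_num))
      ((DGA.GradedGE.map (hP.dm_mem hdm) (ih.mul ih)).mono (by norm_num)))

theorem d_mem_smallSeq (hP : P.IsHodge H B) (hdm : P.toDGA.IsDminus H B dm) (m : ℕ) :
    ∀ x ∈ smallSeq H n dm m, P.d x ∈ smallSeq H n dm m := by
  induction m with
  | zero =>
    intro x hx
    rw [smallSeq, Submodule.mem_bot] at hx ⊢
    rw [hx, map_zero]
  | succ m ih =>
    have hge := gradedGE_smallSeq hP hdm m
    have hdU := DGA.d_mul_mem hge ih
    obtain ⟨p1, p2, p3, p4⟩ := hP.isHarmonicProj hdm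
    set U := smallSeq H n dm m with hU
    have hharm : ∀ x ∈ U * U, P.harm dm x ∈ harmGE H n := by
      have : U * U ≤ (harmGE H n).comap (P.harm dm) :=
        (hge.mul hge).trans <| Submodule.span_le.2 fun x ⟨_, k, hk, hxk⟩ =>
          hP.le_harmGE (by omega) (p4 k x hxk)
      exact this
    suffices h : smallStep H n dm U ≤ (smallStep H n dm U).comap P.d from h
    refine sup_le (iSup₂_le fun k _ x hx => ?_) (sup_le (fun x hx => ?_) ?_)
    · rw [Submodule.mem_comap, hP.d_H hx]
      exact zero_mem _
    · exact Submodule.mem_sup_right (Submodule.mem_sup_left (hdU x hx))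
    · rintro _ ⟨x, hx, rfl⟩
      have h1 : P.d (dm x) = x - dm (P.d x) - P.harm dm x := by
        rw [eq_sub_iff_add_eq, eq_sub_iff_add_eq, add_right_comm]
        exact (P.decomp dm x).symm
      rw [Submodule.mem_comap, h1]
      exact sub_mem (sub_mem (Submodule.mem_sup_right (Submodule.mem_sup_left hx))
        (Submodule.mem_sup_right (Submodule.mem_sup_right ⟨_, hdU x hx, rfl⟩)))
        (Submodule.mem_sup_left (hharm x hx))

theorem smallSeq_succ_le (hP : P.IsHodge H B) (hdm : P.toDGA.IsDminus H B dm) (m : ℕ) :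
    smallSeq H n dm (m + 1) ≤ smallSeq H n dm m ⊔ P.toDGA.filt (m + 2) := by
  induction m with
  | zero =>
    refine le_sup_of_le_right ?_
    simpa using (gradedGE_smallSeq hP hdm 1).le_filt
  | succ m ih =>
    have hge := gradedGE_smallSeq hP hdm
    set U := smallSeq H n dm m
    set V := smallSeq H n dm (m + 1)
    have hF := P.toDGA.gradedGE_filt (m + 2)
    have h1 : V * V ≤ U * U ⊔ P.toDGA.filt (m + 4) := by
      calc V * V ≤ (U ⊔ P.toDGA.filt (m + 2)) * V := mul_le_mul_left ih _
        _ = U * V ⊔ P.toDGA.filt (m + 2) * V := Submodule.sup_mul _ _ _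
        _ ≤ U * (U ⊔ P.toDGA.filt (m + 2)) ⊔ P.toDGA.filt (m + 2) * V :=
          sup_le_sup_right (mul_le_mul_right ih _) _
        _ = U * U ⊔ U * P.toDGA.filt (m + 2) ⊔ P.toDGA.filt (m + 2) * V := by
          rw [Submodule.mul_sup]
        _ ≤ U * U ⊔ P.toDGA.filt (m + 4) := by
          refine sup_le (sup_le le_sup_left (le_sup_of_le_right ?_)) (le_sup_of_le_right ?_)
          · exact (((hge m).mul hF).mono (by omega)).le_filt
          · exact ((hF.mul (hge (m + 1))).mono (by omega)).le_filt
    have h2 : (V * V).map dm ≤ (U * U).map dm ⊔ P.toDGA.filt (m + 3) := by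
      refine (Submodule.map_mono h1).trans ?_
      rw [Submodule.map_sup]
      refine sup_le_sup_left ?_ _
      exact ((DGA.GradedGE.map (hP.dm_mem hdm) (P.toDGA.gradedGE_filt (m + 4))).mono
        (by omega)).le_filt
    have hcast : ((m + 1 : ℕ) : ℤ) + 2 = m + 3 := by push_cast; ring
    rw [hcast]
    refine sup_le (le_sup_of_le_left le_sup_left) (sup_le ?_ ?_)
    · refine h1.trans (sup_le_sup ?_ (P.toDGA.filt_anti (by omega)))
      exact le_sup_of_le_right le_sup_left
    · exact h2.trans (sup_le_sup_right (le_sup_of_le_right le_sup_right) _)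

/-- A simply connected Poincaré DGCA of Hodge type has a finite dimensional graded subalgebra
containing the harmonic subspace and closed under `d` and `d⁻`. -/
theorem IsHodge.exists_small (hP : P.IsHodge H B) (hdm : P.toDGA.IsDminus H B dm)
    (hsc : P.toDGA.RConnected 1) :
    ∃ S : Subalgebra F A, FiniteDimensional F S ∧ (∀ x ∈ S, ∀ i, P.toDGA.proj i x ∈ S) ∧
      (∀ x ∈ S, P.d x ∈ S) ∧ (∀ x ∈ S, dm x ∈ S) ∧ ∀ k, ∀ h ∈ H k, h ∈ S := by
  obtain ⟨m, hm⟩ : ∃ m : ℕ, n < m + 2 := ⟨n.toNat, by omega⟩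
  have hfg := fg_smallSeq (dm := dm) hP m
  have hge := gradedGE_smallSeq hP hdm m
  have hd := d_mem_smallSeq hP hdm m
  have hstep : smallStep H n dm (smallSeq H n dm m) ≤ smallSeq H n dm m := by
    have := smallSeq_succ_le hP hdm m
    rwa [P.filt_eq_bot hm, sup_bot_eq] at this
  set U := smallSeq H n dm m
  have hmul : U * U ≤ U := le_trans (le_sup_of_le_right le_sup_left) hstep
  have hle : U ≤ smallStep H n dm U := smallSeq_le_succ m
  have hHU : ∀ k, 2 ≤ k → H k ≤ U := fun k hk =>
    (hP.le_harmGE hk).trans (le_sup_left.trans hstep)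
  have hdmdm : ∀ x, dm (dm x) = 0 := fun x =>
    P.mem_of_homogeneous (LinearMap.ker (dm ∘ₗ dm))
      (fun k x hx => hdm.2.2.1 _ _ (hdm.2.2.2 k x hx)) x
  have hdmU : U ≤ U.comap dm := by
    refine hle.trans (sup_le (iSup₂_le fun k _ x hx => ?_) (sup_le (fun x hx => ?_) ?_))
    · rw [Submodule.mem_comap, hdm.2.1 k x hx]
      exact zero_mem _
    · exact hstep (Submodule.mem_sup_right (Submodule.mem_sup_right ⟨x, hx, rfl⟩))
    · rintro _ ⟨x, -, rfl⟩
      rw [Submodule.mem_comap, hdmdm]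
      exact zero_mem _
  have hH0 : (1 : A) ∈ H 0 := by
    have h1 := (hP.1 0).2.2 ⟨P.one_mem, P.d_one⟩
    have hB0 : P.toDGA.Bc 0 = ⊥ := by rw [DGA.Bc, P.nonneg _ (by norm_num), Submodule.map_bot]
    rwa [hB0, bot_sup_eq] at h1
  have hdm1 : dm 1 = 0 := hdm.2.1 0 1 hH0
  have hmap : ∀ g : A →ₗ[F] A, (∀ x ∈ U, g x ∈ U) → g 1 ∈ (1 : Submodule F A) ⊔ U →
      ∀ x ∈ (1 : Submodule F A) ⊔ U, g x ∈ (1 : Submodule F A) ⊔ U := fun g hg h1 => by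
    have : (1 : Submodule F A) ⊔ U ≤ ((1 : Submodule F A) ⊔ U).comap g := by
      refine sup_le ?_ fun x hx => Submodule.mem_sup_right (hg x hx)
      rw [Submodule.one_eq_span, Submodule.span_singleton_le_iff_mem, ← Submodule.one_eq_span]
      exact h1
    exact this
  have hone : (1 : A) ∈ (1 : Submodule F A) ⊔ U :=
    Submodule.mem_sup_left (Submodule.one_le.1 le_rfl)
  have hT : ((1 : Submodule F A) ⊔ U) * ((1 : Submodule F A) ⊔ U) ≤ (1 : Submodule F A) ⊔ U := by
    rw [Submodule.sup_mul, one_mul, Submodule.mul_sup, mul_one]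
    exact sup_le le_rfl (sup_le le_sup_right (hmul.trans le_sup_right))
  refine ⟨((1 : Submodule F A) ⊔ U).toSubalgebra hone
    fun x y hx hy => hT (Submodule.mul_mem_mul hx hy), ?_, fun x hx i => ?_, ?_, ?_, ?_⟩
  · refine Module.Finite.iff_fg.2 (?_ : ((1 : Submodule F A) ⊔ U).FG)
    rw [Submodule.one_eq_span]
    exact (Submodule.fg_span_singleton _).sup hfg
  · refine hmap (P.toDGA.proj i) (fun x hx => hge.proj_mem hx i) ?_ x hx
    by_cases hi : 0 = i
    · subst hi
      rwa [P.proj_of_mem P.one_mem]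
    · rw [P.proj_of_mem_ne P.one_mem hi]
      exact zero_mem _
  · exact hmap P.d hd (P.d_one ▸ zero_mem _)
  · exact hmap dm (fun x hx => hdmU hx) (hdm1 ▸ zero_mem _)
  · intro k h hh
    have hhg := hP.H_le k hh
    have hhd := hP.d_H hh
    rcases lt_or_ge k 0 with hk | hk
    · rw [P.nonneg k hk, Submodule.mem_bot] at hhg
      exact hhg ▸ zero_mem _
    rcases lt_or_ge k 2 with hk2 | hk2
    · obtain rfl | rfl : k = 0 ∨ k = 1 := by omega
      · obtain ⟨c, rfl⟩ := hsc.1 h hhg hhd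
        exact Subalgebra.smul_mem _ (one_mem _) c
      · have hB : h ∈ P.toDGA.Bc 1 := P.mem_Bc.2 ⟨hhg, hsc.2 1 le_rfl le_rfl h hhg hhd⟩
        rw [Submodule.disjoint_def.1 (hP.1 1).2.1 h hB hh]
        exact zero_mem _
    · exact Submodule.mem_sup_right (hHU k hk2 hh)

end Small

end PoincareDGCA

/-- Every simply connected Poincaré DGCA of degree `n` of Hodge type is
equivalent to a finite dimensional nondegenerate Poincaré DGCA of degree `n` of Hodge
type. -/
theorem statement_9 {F : Type u} {A : Type v} [Field F] [Ring A] [Algebra F A] {n : ℤ}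
    (P : PoincareDGCA F A n) (hsc : P.toDGA.RConnected 1) (hHodge : P.HodgeType) :
    ∃ (Q : BDGCA.{u, v} F) (PQ : PoincareDGCA F Q.carrier n),
      PQ.toDGCA = Q.str ∧
      FiniteDimensional F Q.carrier ∧
      PQ.perp = ⊥ ∧
      PQ.HodgeType ∧
      DGCAEquivalent (BDGCA.mk A P.toDGCA) Q := by
  obtain ⟨H, B, hP⟩ := hHodge
  obtain ⟨dm, hdm⟩ := hP.exists_isDminus
  obtain ⟨S, hfin, hproj, hd, hdmS, hHS⟩ := hP.exists_small hdm hsc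
  obtain ⟨PS, ⟨H', B', hPS⟩, φ, hφ⟩ := hP.exists_restrict hdm S hproj hd hdmS hHS
  have hker : ∀ x, Ideal.Quotient.mkₐ F PS.perpIdeal x = 0 ↔ x ∈ PS.perp := fun x =>
    Ideal.Quotient.eq_zero_iff_mem
  have hsurj := Ideal.Quotient.mkₐ_surjective F PS.perpIdeal
  have hfinQ : FiniteDimensional F (S ⧸ PS.perpIdeal) :=
    Module.Finite.of_surjective (Ideal.Quotient.mkₐ F PS.perpIdeal).toLinearMap hsurj
  obtain ⟨PQ, hperp, hHodgeQ, ψ, hψ⟩ := hPS.exists_quotient _ hsurj hker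
  exact ⟨BDGCA.mk (S ⧸ PS.perpIdeal) PQ.toDGCA, PQ, rfl, hfinQ, hperp, hHodgeQ,
    .trans _ _ _ (.symm _ _ (.rel _ _ ⟨φ, hφ⟩)) (.rel _ _ ⟨ψ, hψ⟩)⟩
end

section
/- Let A* be a Poincaré DGCA of degree n of Hodge type with harmonic subspace H*. Then for all homogeneous α, β, γ ∈ H* the trilinear map m3 satisfies the Harrison (shuffle) cocycle identity: m3(α,β,γ) − (−1)^{|α||β|} m3(β,α,γ) + (−1)^{|α|(|β|+|γ|)} m3(β,γ,α) = 0. -/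
universe u v

open scoped TensorProduct

variable {F : Type u} {A : Type v} [Field F] [Ring A] [Algebra F A]

/-- The binary multiplication `m₂(α,β) = π_H(α·β)` on the harmonic subspace. -/
def m2 (pH : A →ₗ[F] A) (a b : A) : A := pH (a * b)

/-- The ternary multiplication
`m₃(α,β,γ) = π_H(d⁻(α·β)·γ - (-1)^{|α|} α·d⁻(β·γ))`, for `α` of degree `i`. -/
def m3 (pH dm : A →ₗ[F] A) (i : ℤ) (a b c : A) : A :=
  pH (dm (a * b) * c - ((-1 : F) ^ i) • (a * dm (b * c)))

theorem neg_one_zpow_mul_self_eq_one {F : Type*} [Field F] (i : ℤ) :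
    (-1 : F) ^ i * (-1 : F) ^ i = 1 := by
  rw [← mul_zpow]
  simp

/-- For a Poincaré DGCA of Hodge type with harmonic subspace `H`, the
trilinear map `m₃` satisfies the Harrison (shuffle) cocycle identity
`m₃(α,β,γ) - (-1)^{|α||β|} m₃(β,α,γ) + (-1)^{|α|(|β|+|γ|)} m₃(β,γ,α) = 0`. -/
theorem statement_12 {n : ℤ} (P : PoincareDGCA F A n)
    (H B : ℤ → Submodule F A) (hHodge : P.IsHodge H B)
    (dm : A →ₗ[F] A) (hdm : P.toDGA.IsDminus H B dm)
    (pH : A →ₗ[F] A) (hpH : P.toDGA.IsHarmonicProj H B pH) :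
    ∀ (i j k : ℤ) (α β γ : A), α ∈ H i → β ∈ H j → γ ∈ H k →
      m3 pH dm i α β γ - ((-1 : F) ^ (i * j)) • m3 pH dm j β α γ
          + ((-1 : F) ^ (i * (j + k))) • m3 pH dm j β γ α = 0 := by
  intro i j k α β γ hα hβ hγ
  have hα' : α ∈ P.grading i := (hHodge.1 i).1 hα |>.1
  have hβ' : β ∈ P.grading j := (hHodge.1 j).1 hβ |>.1
  have hγ' : γ ∈ P.grading k := (hHodge.1 k).1 hγ |>.1
  have hdβγ : dm (β * γ) ∈ P.grading (j + k - 1) :=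
    hHodge.2.1 _ (hdm.2.2.2 _ _ (P.mul_mem hβ' hγ'))
  have hβα := P.gcomm β α hβ' hα'
  have hγα := P.gcomm γ α hγ' hα'
  have hcomm := P.gcomm _ α hdβγ hα'
  have hsign : (-1 : F) ^ ((j + k - 1) * i)
      = (-1 : F) ^ (i * j) * (-1 : F) ^ (i * k) * (-1 : F) ^ i := by
    rw [← zpow_add₀ (by simp), ← zpow_add₀ (by simp),
      show i * j + i * k + i = (j + k - 1) * i + (i + i) by ring,
      zpow_add₀ (by simp), zpow_add₀ (by simp) i i, neg_one_zpow_mul_self_eq_one, mul_one]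
  have hij := neg_one_zpow_mul_self_eq_one (F := F) (i * j)
  have hik := neg_one_zpow_mul_self_eq_one (F := F) (i * k)
  rw [hsign] at hcomm
  rw [mul_comm j i] at hβα
  rw [mul_comm k i] at hγα
  simp only [m3]
  rw [hcomm, hβα, hγα, mul_add, zpow_add₀ (by simp)]
  simp only [← map_smul, ← map_sub, ← map_add]
  simp only [map_smul, smul_mul_assoc, mul_smul_comm]
  convert map_zero pH using 2
  match_scalars
  · linear_combination -hij
  · linear_combination
      ((-1 : F) ^ i * ((-1 : F) ^ (i * k) * (-1 : F) ^ (i * k))) * hij + (-1 : F) ^ i * hik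
  · linear_combination -(((-1 : F) ^ (i * j) * (-1 : F) ^ j) * hik)
end

section
/- Let A* be a simply connected Poincaré DGCA of degree n of Hodge type. Then: (1) if n ≤ 6, every triple Massey product of A* is trivial; (2) if n = 7, the triple Massey product ⟨x,y,z⟩ is trivial for every Massey 3-tuple (x,y,z) of degree (|x|,|y|,|z|) ≠ (2,2,2); (3) if n = 8, the triple Massey product ⟨x,y,z⟩ is trivial for every Massey 3-tuple (x,y,z) of degree not belonging to {(2,2,2), (2,2,3), (2,3,2), (3,2,2)}. -/
universe u v

open scoped TensorProduct

namespace DGA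

variable {F : Type u} {A : Type v} [Field F] [Ring A] [Algebra F A]

theorem degSum_self (deg : ℕ → ℤ) (i : ℕ) : degSum deg i i = deg i := by
  simp [degSum]

theorem degSum_succ (deg : ℕ → ℤ) (i : ℕ) :
    degSum deg i (i + 1) = deg i + deg (i + 1) - 1 := by
  simp [degSum, Finset.sum_Icc_succ_top]

theorem masseyOut_three (D : DGA F A) (deg : ℕ → ℤ) (a : ℕ → ℕ → A) :
    D.masseyOut 3 deg a = ((-1 : F) ^ deg 1) • (a 1 1 * a 2 3) +
      ((-1 : F) ^ (deg 1 + deg 2 - 1)) • (a 1 2 * a 3 3) := by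
  simp [masseyOut, Finset.sum_Ico_succ_top, degSum_self, degSum_succ deg 1]

/-- The data `a`, `b`, `c`, `u`, `v` of a defining system `a₁₁`, `a₂₂`, `a₃₃`, `a₁₂`, `a₂₃` of a
triple Massey product. -/
structure IsTripleSystem (D : DGA F A) (deg : ℕ → ℤ) (x : ℕ → A) (a b c u v : A) : Prop where
  mem_a : a ∈ D.grading (deg 1)
  mem_b : b ∈ D.grading (deg 2)
  mem_c : c ∈ D.grading (deg 3)
  mem_u : u ∈ D.grading (deg 1 + deg 2 - 1)
  mem_v : v ∈ D.grading (deg 2 + deg 3 - 1)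
  d_a : D.d a = 0
  d_b : D.d b = 0
  d_c : D.d c = 0
  d_u : D.d u = ((-1 : F) ^ deg 1) • (a * b)
  d_v : D.d v = ((-1 : F) ^ deg 2) • (b * c)
  coh_a : D.Cohomologous a (x 1)
  coh_b : D.Cohomologous b (x 2)
  coh_c : D.Cohomologous c (x 3)

/-- The cocycle produced by a triple system. -/
def tripleOut (_ : DGA F A) (deg : ℕ → ℤ) (a c u v : A) : A :=
  ((-1 : F) ^ deg 1) • (a * v) + ((-1 : F) ^ (deg 1 + deg 2 - 1)) • (u * c)

theorem IsDefiningSystem.isTripleSystem {D : DGA F A} {deg : ℕ → ℤ} {x : ℕ → A}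
    {a : ℕ → ℕ → A} (h : D.IsDefiningSystem 3 deg x a) :
    D.IsTripleSystem deg x (a 1 1) (a 2 2) (a 3 3) (a 1 2) (a 2 3) := by
  obtain ⟨h₁, h₂, h₃⟩ := h
  obtain ⟨ma, da, ca⟩ := h₁ 1 (by norm_num) (by norm_num)
  obtain ⟨mb, db, cb⟩ := h₁ 2 (by norm_num) (by norm_num)
  obtain ⟨mc, dc, cc⟩ := h₁ 3 (by norm_num) (by norm_num)
  have mu := h₂ 1 2 (by norm_num) (by norm_num) (by norm_num)
  have mv := h₂ 2 3 (by norm_num) (by norm_num) (by norm_num)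
  have du := h₃ 1 2 (by norm_num) (by norm_num) (by norm_num) (by norm_num)
  have dv := h₃ 2 3 (by norm_num) (by norm_num) (by norm_num) (by norm_num)
  rw [degSum_succ deg 1] at mu
  rw [degSum_succ deg 2] at mv
  simp only [Nat.Ico_succ_singleton, Finset.sum_singleton, degSum_self] at du dv
  exact ⟨ma, mb, mc, mu, mv, da, db, dc, du, dv, ca, cb, cc⟩

theorem IsTripleSystem.masseyTrivial {D : DGA F A} {deg : ℕ → ℤ} {x : ℕ → A} {a b c u v : A}
    (h : D.IsTripleSystem deg x a b c u v) (he : D.IsExact (D.tripleOut deg a c u v)) :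
    D.MasseyTrivial 3 deg x := by
  let s : ℕ → ℕ → A
    | 1, 1 => a
    | 2, 2 => b
    | 3, 3 => c
    | 1, 2 => u
    | 2, 3 => v
    | _, _ => 0
  refine ⟨s, ⟨?_, ?_, ?_⟩, by rw [masseyOut_three]; exact he⟩
  · intro i h₁ h₂
    interval_cases i
    exacts [⟨h.mem_a, h.d_a, h.coh_a⟩, ⟨h.mem_b, h.d_b, h.coh_b⟩, ⟨h.mem_c, h.d_c, h.coh_c⟩]
  · intro i j h₁ h₂ h₃
    have hj : 1 ≤ j := h₁.trans h₂
    have hi : i ≤ 3 := h₂.trans h₃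
    interval_cases i <;> interval_cases j <;> try omega
    · rw [degSum_self]; exact h.mem_a
    · rw [degSum_succ deg 1]; exact h.mem_u
    · exact Submodule.zero_mem _
    · rw [degSum_self]; exact h.mem_b
    · rw [degSum_succ deg 2]; exact h.mem_v
    · rw [degSum_self]; exact h.mem_c
  · intro i j h₁ h₂ h₃ h₄
    have hj : 1 ≤ j := h₁.trans h₂.le
    have hi : i ≤ 3 := h₂.le.trans h₃
    interval_cases i <;> interval_cases j <;> try omega
    · simp only [Nat.Ico_succ_singleton, Finset.sum_singleton, degSum_self]
      exact h.d_u
    · simp only [Nat.Ico_succ_singleton, Finset.sum_singleton, degSum_self]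
      exact h.d_v

theorem cohomologous_zero_of_isExact {D : DGA F A} {a y : A} (h : D.Cohomologous a y)
    (ha : D.IsExact a) : D.Cohomologous 0 y := by
  obtain ⟨e, he⟩ := h
  obtain ⟨f, rfl⟩ := ha
  exact ⟨e - f, by rw [map_sub, ← he]; abel⟩

theorem IsTripleSystem.masseyTrivial_of_isExact {D : DGA F A} {deg : ℕ → ℤ} {x : ℕ → A}
    {a b c u v : A} (h : D.IsTripleSystem deg x a b c u v)
    (he : D.IsExact a ∨ D.IsExact b ∨ D.IsExact c) : D.MasseyTrivial 3 deg x := by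
  rcases he with he | he | he
  · have h' : D.IsTripleSystem deg x 0 b c 0 v :=
      { h with
        mem_a := zero_mem _, mem_u := zero_mem _, d_a := map_zero _, d_u := by simp
        coh_a := cohomologous_zero_of_isExact h.coh_a he }
    exact h'.masseyTrivial ⟨0, by simp [tripleOut]⟩
  · have h' : D.IsTripleSystem deg x a 0 c 0 0 :=
      { h with
        mem_b := zero_mem _, mem_u := zero_mem _, mem_v := zero_mem _, d_b := map_zero _
        d_u := by simp
        d_v := by simp
        coh_b := cohomologous_zero_of_isExact h.coh_b he }
    exact h'.masseyTrivial ⟨0, by simp [tripleOut]⟩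
  · have h' : D.IsTripleSystem deg x a b 0 u 0 :=
      { h with
        mem_c := zero_mem _, mem_v := zero_mem _, d_c := map_zero _, d_v := by simp
        coh_c := cohomologous_zero_of_isExact h.coh_c he }
    exact h'.masseyTrivial ⟨0, by simp [tripleOut]⟩

theorem isExact_of_smul_eq_d {D : DGA F A} {t : F} (ht : t ≠ 0) {a e : A}
    (h : D.d e = t • a) : D.IsExact a :=
  ⟨t⁻¹ • e, by rw [map_smul, h, inv_smul_smul₀ ht]⟩

theorem neg_one_zpow_ne_zero (i : ℤ) : ((-1 : F) ^ i) ≠ 0 :=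
  zpow_ne_zero _ (neg_ne_zero.mpr one_ne_zero)

/-- In a simply connected DGA a homogeneous cocycle of degree at most one is exact, unless it is a
nonzero scalar. -/
theorem isExact_or_eq_smul_one {D : DGA F A} (hsc : D.RConnected 1) {k : ℤ} (hk : k ≤ 1)
    {a : A} (ha : a ∈ D.grading k) (hd : D.d a = 0) :
    D.IsExact a ∨ ∃ t : F, t ≠ 0 ∧ a = t • (1 : A) := by
  rcases lt_trichotomy k 0 with h | rfl | h
  · rw [D.nonneg k h, Submodule.mem_bot] at ha
    exact .inl ⟨0, by simp [ha]⟩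
  · obtain ⟨t, rfl⟩ := hsc.1 a ha hd
    by_cases ht : t = 0
    · exact .inl ⟨0, by simp [ht]⟩
    · exact .inr ⟨t, ht, rfl⟩
  · exact .inl (hsc.2 k h hk a ha hd)

theorem IsTripleSystem.masseyTrivial_of_le_one {D : DGA F A} (hsc : D.RConnected 1)
    {deg : ℕ → ℤ} {x : ℕ → A} {a b c u v : A} (h : D.IsTripleSystem deg x a b c u v)
    (hdeg : deg 1 ≤ 1 ∨ deg 2 ≤ 1 ∨ deg 3 ≤ 1) : D.MasseyTrivial 3 deg x := by
  refine h.masseyTrivial_of_isExact ?_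
  rcases hdeg with hk | hk | hk
  · rcases isExact_or_eq_smul_one hsc hk h.mem_a h.d_a with he | ⟨t, ht, rfl⟩
    · exact .inl he
    · refine .inr (.inl (isExact_of_smul_eq_d (mul_ne_zero (neg_one_zpow_ne_zero (deg 1)) ht)
        (e := u) ?_))
      rw [h.d_u, smul_mul_assoc, one_mul, mul_smul]
  · rcases isExact_or_eq_smul_one hsc hk h.mem_b h.d_b with he | ⟨t, ht, rfl⟩
    · exact .inr (.inl he)
    · refine .inl (isExact_of_smul_eq_d (mul_ne_zero (neg_one_zpow_ne_zero (deg 1)) ht)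
        (e := u) ?_)
      rw [h.d_u, mul_smul_comm, mul_one, mul_smul]
  · rcases isExact_or_eq_smul_one hsc hk h.mem_c h.d_c with he | ⟨t, ht, rfl⟩
    · exact .inr (.inr he)
    · refine .inr (.inl (isExact_of_smul_eq_d (mul_ne_zero (neg_one_zpow_ne_zero (deg 2)) ht)
        (e := v) ?_))
      rw [h.d_v, mul_smul_comm, mul_one, mul_smul]

theorem IsTripleSystem.tripleOut_mem {D : DGA F A} {deg : ℕ → ℤ} {x : ℕ → A} {a b c u v : A}
    (h : D.IsTripleSystem deg x a b c u v) :
    D.tripleOut deg a c u v ∈ D.grading (deg 1 + deg 2 + deg 3 - 1) := by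
  refine add_mem (Submodule.smul_mem _ _ ?_) (Submodule.smul_mem _ _ ?_)
  · convert D.mul_mem h.mem_a h.mem_v using 2; ring
  · convert D.mul_mem h.mem_u h.mem_c using 2; ring

theorem IsTripleSystem.d_tripleOut {D : DGA F A} {deg : ℕ → ℤ} {x : ℕ → A} {a b c u v : A}
    (h : D.IsTripleSystem deg x a b c u v) : D.d (D.tripleOut deg a c u v) = 0 := by
  have hne : (-1 : F) ≠ 0 := neg_ne_zero.mpr one_ne_zero
  have hsq : ((-1 : F) ^ deg 1) * (-1) ^ deg 1 = 1 := by
    rw [← mul_zpow]; simp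
  rw [tripleOut, map_add, map_smul, map_smul, D.leibniz _ _ h.mem_a, D.leibniz _ _ h.mem_u,
    h.d_a, h.d_c, h.d_u, h.d_v]
  simp only [zero_mul, mul_zero, smul_zero, zero_add, add_zero, mul_smul_comm, smul_mul_assoc,
    smul_smul, mul_assoc]
  rw [← add_smul, zpow_sub_one₀ hne, zpow_add₀ hne]
  convert zero_smul F _
  linear_combination (1 + (-1 : F)⁻¹) * (-1 : F) ^ deg 2 * hsq

end DGA

namespace PoincareDGCA

variable {F : Type u} {A : Type v} [Field F] [Ring A] [Algebra F A] {n : ℤ}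

theorem isExact_of_intg_eq_zero (P : PoincareDGCA F A n) (hc : P.toDGA.Connected) {a : A}
    (ha : a ∈ P.grading n) (hd : P.d a = 0) (hint : P.intg a = 0) : P.toDGA.IsExact a := by
  refine P.nondeg n a ha hd fun b hb hdb => ?_
  rw [sub_self] at hb
  obtain ⟨t, rfl⟩ := hc b hb hdb
  simp [hint]

theorem isExact_of_mem_sub_one (P : PoincareDGCA F A n) (hsc : P.toDGA.RConnected 1) {a : A}
    (ha : a ∈ P.grading (n - 1)) (hd : P.d a = 0) : P.toDGA.IsExact a := by
  refine P.nondeg (n - 1) a ha hd fun b hb hdb => ?_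
  rw [sub_sub_cancel] at hb
  obtain ⟨e, rfl⟩ := hsc.2 1 le_rfl le_rfl b hb hdb
  have h := P.intg_d (a * e)
  rw [P.leibniz a e ha, hd, zero_mul, zero_add, map_smul, smul_eq_mul] at h
  exact (mul_eq_zero.mp h).resolve_left (DGA.neg_one_zpow_ne_zero _)

/-- A triple Massey product of degree at least `n - 1` is trivial. -/
theorem masseyTrivial_three_of_le (P : PoincareDGCA F A n) (hsc : P.toDGA.RConnected 1)
    {deg : ℕ → ℤ} {x : ℕ → A} (hx : P.toDGA.IsMasseyTuple 3 deg x)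
    (hn : 2 ≤ deg 1 → 2 ≤ deg 2 → 2 ≤ deg 3 → n ≤ deg 1 + deg 2 + deg 3) :
    P.toDGA.MasseyTrivial 3 deg x := by
  obtain ⟨-, s, hs⟩ := hx
  have h := hs.isTripleSystem
  generalize s 1 1 = a, s 2 2 = b, s 3 3 = c, s 1 2 = u, s 2 3 = v at h
  by_cases hdeg : deg 1 ≤ 1 ∨ deg 2 ≤ 1 ∨ deg 3 ≤ 1
  · exact h.masseyTrivial_of_le_one hsc hdeg
  replace hn : n ≤ deg 1 + deg 2 + deg 3 := by
    apply hn <;> omega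
  have hm := h.tripleOut_mem
  obtain h' | h' | h' : deg 1 + deg 2 + deg 3 - 1 = n - 1 ∨ deg 1 + deg 2 + deg 3 - 1 = n ∨
      n < deg 1 + deg 2 + deg 3 - 1 := by omega
  · rw [h'] at hm
    exact h.masseyTrivial (P.isExact_of_mem_sub_one hsc hm h.d_tripleOut)
  · by_cases he : P.toDGA.IsExact a
    · exact h.masseyTrivial_of_isExact (.inl he)
    obtain ⟨w, hw, hdw, hint⟩ : ∃ w ∈ P.grading (n - deg 1), P.d w = 0 ∧ P.intg (a * w) ≠ 0 := by
      by_contra! hcon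
      exact he (P.nondeg _ a h.mem_a h.d_a hcon)
    have hne := DGA.neg_one_zpow_ne_zero (F := F) (deg 1)
    have hk : P.toDGA.IsTripleSystem deg x a b c u (v -
        (P.intg (P.tripleOut deg a c u v) / ((-1 : F) ^ deg 1 * P.intg (a * w))) • w) :=
      { h with
        mem_v := sub_mem h.mem_v (Submodule.smul_mem _ _ (by convert hw using 2; omega))
        d_v := by rw [map_sub, map_smul, hdw, smul_zero, sub_zero, h.d_v] }
    refine hk.masseyTrivial (P.isExact_of_intg_eq_zero hsc.1 ?_ hk.d_tripleOut ?_)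
    · exact h' ▸ hk.tripleOut_mem
    · simp only [DGA.tripleOut, mul_sub, map_add, map_sub, map_smul, smul_eq_mul, mul_smul_comm]
      field_simp
      ring
  · rw [P.top _ h', Submodule.mem_bot] at hm
    exact h.masseyTrivial ⟨0, by rw [hm, map_zero]⟩

end PoincareDGCA

/-- Let `A*` be a simply connected Poincaré DGCA of degree `n` of
Hodge type.  (1) If `n ≤ 6`, every triple Massey product is trivial.  (2) If `n = 7`,
the triple Massey product is trivial for every Massey triple of degree `≠ (2,2,2)`.
(3) If `n = 8`, it is trivial for every Massey triple of degree not in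
`{(2,2,2), (2,2,3), (2,3,2), (3,2,2)}`. -/
theorem statement_15 {F : Type u} {A : Type v} [Field F] [Ring A] [Algebra F A] {n : ℤ}
    (P : PoincareDGCA F A n) (hsc : P.toDGA.RConnected 1) (hHodge : P.HodgeType) :
    (n ≤ 6 → ∀ (deg : ℕ → ℤ) (x : ℕ → A),
      P.toDGA.IsMasseyTuple 3 deg x → P.toDGA.MasseyTrivial 3 deg x) ∧
    (n = 7 → ∀ (deg : ℕ → ℤ) (x : ℕ → A),
      P.toDGA.IsMasseyTuple 3 deg x →
      ¬(deg 1 = 2 ∧ deg 2 = 2 ∧ deg 3 = 2) →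
      P.toDGA.MasseyTrivial 3 deg x) ∧
    (n = 8 → ∀ (deg : ℕ → ℤ) (x : ℕ → A),
      P.toDGA.IsMasseyTuple 3 deg x →
      ¬((deg 1 = 2 ∧ deg 2 = 2 ∧ deg 3 = 2) ∨ (deg 1 = 2 ∧ deg 2 = 2 ∧ deg 3 = 3) ∨
        (deg 1 = 2 ∧ deg 2 = 3 ∧ deg 3 = 2) ∨ (deg 1 = 3 ∧ deg 2 = 2 ∧ deg 3 = 2)) →
      P.toDGA.MasseyTrivial 3 deg x) := by
  refine ⟨fun hn deg x hx => ?_, fun hn deg x hx hdeg => ?_, fun hn deg x hx hdeg => ?_⟩ <;>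
    refine P.masseyTrivial_three_of_le hsc hx fun h₁ h₂ h₃ => ?_ <;> omega
end
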